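/- arXiv:math/0502396 — 13 statements merged into one kernel-verified Lean document; each statement's English description precedes it below -/
import Mathlib

section
/- Let R be a commutative ring that is a ℚ-algebra, equipped with a derivation d : R → R. If I is a differential ideal of R that is maximal among the proper differential ideals of R, then I is a prime ideal. -/
namespace Derivation

variable {R : Type*} [CommRing R] (D : Derivation ℤ R R) {I : Ideal R}

theorem exists_pow_apply_mem_of_pow_mul_pow_mem [Algebra ℚ R] (hI : ∀ a ∈ I, D a ∈ I)
    {a : R} (m j : ℕ) (h : a ^ m * D a ^ j ∈ I) : ∃ k, D a ^ k ∈ I := by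
  induction m generalizing j with
  | zero => exact ⟨j, by simpa using h⟩
  | succ m ih =>
    refine ih (j + 2) ?_
    have hmul : ((m : ℚ) + 1) • (a ^ m * D a ^ (j + 2)) ∈ I := by
      have hsub := I.sub_mem (I.mul_mem_left (D a) (hI _ h))
        (I.mul_mem_left ((j : R) * D (D a)) h)
      convert hsub using 1
      rw [Algebra.smul_def]
      cases j with
      | zero => simp [leibniz_pow]; ring
      | succ j => simp [leibniz, leibniz_pow]; ring
    have hm : (m : ℚ) + 1 ≠ 0 := by positivity
    simpa [smul_smul, inv_mul_cancel₀ hm] using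
      I.smul_of_tower_mem ((m : ℚ) + 1)⁻¹ hmul

theorem apply_mem_radical [Algebra ℚ R] (hI : ∀ a ∈ I, D a ∈ I) {a : R}
    (ha : a ∈ I.radical) : D a ∈ I.radical := by
  obtain ⟨n, hn⟩ := ha
  exact D.exists_pow_apply_mem_of_pow_mul_pow_mem hI n 0 (by simpa using hn)

theorem apply_mul_mem_of_isRadical (hI : ∀ a ∈ I, D a ∈ I) (hrad : I.IsRadical) {a s : R}
    (h : a * s ∈ I) : D a * s ∈ I := by
  refine hrad ⟨2, ?_⟩
  have hsub := I.sub_mem (I.mul_mem_left (D a * s) (hI _ h)) (I.mul_mem_left (D a * D s) h)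
  convert hsub using 1
  simp only [leibniz, smul_eq_mul]
  ring

end Derivation


/-- If `R` is a commutative ring that is a `ℚ`-algebra equipped with a derivation `d`,
then any ideal that is maximal among proper differential ideals is prime. -/
theorem maximal_differential_ideal_isPrime
    {R : Type*} [CommRing R] [Algebra ℚ R] (d : R → R)
    (hd_add : ∀ a b : R, d (a + b) = d a + d b)
    (hd_mul : ∀ a b : R, d (a * b) = a * d b + d a * b)
    (I : Ideal R)
    (hI_diff : ∀ a ∈ I, d a ∈ I)
    (hI_proper : I ≠ ⊤)
    (hI_max : ∀ J : Ideal R, (∀ a ∈ J, d a ∈ J) → J ≠ ⊤ → I ≤ J → J = I) :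
    I.IsPrime := by
  let D : Derivation ℤ R R :=
    Derivation.mk' (AddMonoidHom.mk' d hd_add).toIntLinearMap fun a b => by
      simp [hd_mul, mul_comm (d a)]
  have hrad : I.IsRadical := by
    exact (hI_max I.radical (fun a ha => D.apply_mem_radical hI_diff ha)
      (mt Ideal.radical_eq_top.mp hI_proper) Ideal.le_radical).le
  refine ⟨hI_proper, fun {a b} hab => or_iff_not_imp_right.mpr fun hb => ?_⟩
  have hcolon := hI_max (Submodule.comap (LinearMap.mulRight R b) I)
    (fun x hx => D.apply_mul_mem_of_isRadical hI_diff hrad hx)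
    (fun htop => hb (by simpa using (Ideal.eq_top_iff_one _).mp htop))
    (fun x hx => I.mul_mem_right b hx)
  exact hcolon.le hab
end

section
/- Let R be a commutative ring that is a ℚ-algebra, equipped with a derivation d : R → R. If I is a differential ideal of R, then its radical √I is also a differential ideal of R. -/
/-- If a differential ideal of a `ℚ`-algebra contains `a ^ (m + 1) * D a ^ j`, then it contains
`a ^ m * D a ^ (j + 2)`. -/
theorem Derivation.pow_mul_pow_add_two_mem {R : Type*} [CommRing R] [Algebra ℚ R]
    (D : Derivation ℤ R R) {I : Ideal R} (hI : ∀ a ∈ I, D a ∈ I) {a : R} {m j : ℕ}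
    (h : a ^ (m + 1) * D a ^ j ∈ I) : a ^ m * D a ^ (j + 2) ∈ I := by
  have hb : D a * D (D a ^ j) = j * D a ^ j * D (D a) := by
    cases j with
    | zero => simp
    | succ j =>
      simp only [Derivation.leibniz_pow, Nat.add_sub_cancel, smul_eq_mul, nsmul_eq_mul]
      ring
  have key : ((m + 1 : ℕ) : R) * (a ^ m * D a ^ (j + 2)) ∈ I := by
    have hdiff := I.sub_mem (I.mul_mem_left (D a) (hI _ h)) (I.mul_mem_left (j * D (D a)) h)
    convert hdiff using 1
    simp only [Derivation.leibniz, D.leibniz_pow (a := a), Nat.add_sub_cancel, smul_eq_mul,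
      nsmul_eq_mul]
    linear_combination (-a ^ (m + 1)) * hb
  have hunit : IsUnit ((m + 1 : ℕ) : R) := by
    rw [← _root_.map_natCast (algebraMap ℚ R)]
    exact (IsUnit.mk0 _ (Nat.cast_ne_zero.mpr m.succ_ne_zero)).map _
  exact (I.unit_mul_mem_iff_mem hunit).mp key

/-- If a differential ideal of a `ℚ`-algebra contains `a ^ n * D a ^ j`, then it contains
`D a ^ (j + 2 * n)`. -/
theorem Derivation.pow_add_two_mul_mem {R : Type*} [CommRing R] [Algebra ℚ R]
    (D : Derivation ℤ R R) {I : Ideal R} (hI : ∀ a ∈ I, D a ∈ I) {a : R} {n j : ℕ}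
    (h : a ^ n * D a ^ j ∈ I) : D a ^ (j + 2 * n) ∈ I := by
  induction n generalizing j with
  | zero => simpa using h
  | succ n ih =>
    have := ih (D.pow_mul_pow_add_two_mem hI h)
    rwa [show j + 2 * (n + 1) = j + 2 + 2 * n by ring]

/-- If `R` is a commutative ring that is a `ℚ`-algebra equipped with a derivation `d`,
then the radical of a differential ideal is again a differential ideal. -/
theorem radical_of_differential_ideal_is_differential
    {R : Type*} [CommRing R] [Algebra ℚ R] (d : R → R)
    (hd_add : ∀ a b : R, d (a + b) = d a + d b)
    (hd_mul : ∀ a b : R, d (a * b) = a * d b + d a * b)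
    (I : Ideal R)
    (hI_diff : ∀ a ∈ I, d a ∈ I) :
    ∀ a ∈ I.radical, d a ∈ I.radical := by
  rintro a ⟨n, hn⟩
  let D : Derivation ℤ R R := Derivation.mk' (AddMonoidHom.mk' d hd_add).toIntLinearMap
    fun x y ↦ (hd_mul x y).trans (by simp [mul_comm])
  exact ⟨0 + 2 * n, D.pow_add_two_mul_mem hI_diff (a := a) (j := 0) (by simpa using hn)⟩
end

section
/- Let R be a commutative ring that is a ℚ-algebra, equipped with a derivation d : R → R. Then every proper radical differential ideal of R is the intersection of the prime differential ideals of R containing it. -/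
section RadicalDifferentialIdeal

variable {R : Type*} [CommRing R]

/-- The ideal quotient `J : b` of a radical ideal is radical. -/
theorem Ideal.IsRadical.colon_singleton {J : Ideal R} (hJ : J.IsRadical) (b : R) :
    (J.colon {b}).IsRadical := by
  rintro x ⟨n, hn⟩
  rw [Submodule.mem_colon_singleton, smul_eq_mul] at hn ⊢
  refine hJ ⟨n + 1, ?_⟩
  have h : (x * b) ^ (n + 1) = x ^ n * b * (x * b ^ n) := by ring
  exact h ▸ J.mul_mem_right _ hn

/-- The ideal quotient `J : b` of a radical differential ideal is differential. -/
theorem Ideal.IsRadical.map_mem_colon_singleton {d : R → R}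
    (hd_mul : ∀ a b : R, d (a * b) = a * d b + d a * b) {J : Ideal R} (hJ : J.IsRadical)
    (hJd : ∀ a ∈ J, d a ∈ J) (b : R) {x : R} (hx : x ∈ J.colon {b}) : d x ∈ J.colon {b} := by
  rw [Submodule.mem_colon_singleton, smul_eq_mul] at hx ⊢
  refine hJ ⟨2, ?_⟩
  have h : (d x * b) ^ 2 = d x * b * d (x * b) - d x * d b * (x * b) := by
    rw [hd_mul]; ring
  exact h ▸ J.sub_mem (J.mul_mem_left _ (hJd _ hx)) (J.mul_mem_left _ hx)

/-- A radical differential ideal that is maximal among those not containing `f` is prime. -/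
theorem Ideal.isPrime_of_maximal_radical_differential {d : R → R}
    (hd_mul : ∀ a b : R, d (a * b) = a * d b + d a * b) {f : R} {J : Ideal R}
    (hJ : Maximal (fun K : Ideal R ↦ K.IsRadical ∧ (∀ a ∈ K, d a ∈ K) ∧ f ∉ K) J) :
    J.IsPrime := by
  obtain ⟨hJr, hJd, hfJ⟩ := hJ.prop
  have key {a b : R} (hab : a * b ∈ J) (ha : a ∉ J) : f * b ∈ J := by
    by_contra hfb
    have hle : J ≤ J.colon {b} := fun x hx ↦
      Submodule.mem_colon_singleton.2 (J.mul_mem_right b hx)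
    refine ha (hJ.le_of_ge ⟨hJr.colon_singleton b,
      fun x hx ↦ hJr.map_mem_colon_singleton hd_mul hJd b hx, fun h ↦ hfb ?_⟩ hle
      (Submodule.mem_colon_singleton.2 hab))
    exact Submodule.mem_colon_singleton.1 h
  refine ⟨fun h ↦ hfJ (h ▸ Submodule.mem_top), fun {a b} hab ↦ ?_⟩
  by_contra! h
  have hbf : b * f ∈ J := mul_comm f b ▸ key hab h.1
  exact hfJ (hJr ⟨2, sq f ▸ key hbf h.2⟩)

/-- A radical differential ideal not containing `f` is contained in a maximal such ideal. -/
theorem Ideal.exists_le_maximal_radical_differential (d : R → R) {f : R} {I : Ideal R}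
    (hI : I.IsRadical) (hId : ∀ a ∈ I, d a ∈ I) (hf : f ∉ I) :
    ∃ J, I ≤ J ∧ Maximal (fun K : Ideal R ↦ K.IsRadical ∧ (∀ a ∈ K, d a ∈ K) ∧ f ∉ K) J := by
  refine zorn_le_nonempty₀ {K : Ideal R | K.IsRadical ∧ (∀ a ∈ K, d a ∈ K) ∧ f ∉ K}
    (fun c hc hchain K hK ↦ ?_) I ⟨hI, hId, hf⟩
  have hmem {x : R} : x ∈ sSup c ↔ ∃ L ∈ c, x ∈ L :=
    Submodule.mem_sSup_of_directed ⟨K, hK⟩ hchain.directedOn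
  refine ⟨sSup c, ⟨?_, fun a ha ↦ ?_, fun h ↦ ?_⟩, fun L hL ↦ le_sSup hL⟩
  · rintro x ⟨n, hn⟩
    obtain ⟨L, hL, hxL⟩ := hmem.1 hn
    exact hmem.2 ⟨L, hL, (hc hL).1 ⟨n, hxL⟩⟩
  · obtain ⟨L, hL, haL⟩ := hmem.1 ha
    exact hmem.2 ⟨L, hL, (hc hL).2.1 a haL⟩
  · obtain ⟨L, hL, hfL⟩ := hmem.1 h
    exact (hc hL).2.2 hfL

end RadicalDifferentialIdeal


/-- Over a `ℚ`-algebra with a derivation `d`, every proper radical differential ideal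
is the intersection of the prime differential ideals containing it. -/
theorem radical_differential_ideal_eq_sInf_prime_differential
    {R : Type*} [CommRing R] [Algebra ℚ R] (d : R → R)
    (hd_add : ∀ a b : R, d (a + b) = d a + d b)
    (hd_mul : ∀ a b : R, d (a * b) = a * d b + d a * b)
    (I : Ideal R)
    (hI_diff : ∀ a ∈ I, d a ∈ I)
    (hI_rad : I.radical = I)
    (hI_proper : I ≠ ⊤) :
    I = sInf {J : Ideal R | J.IsPrime ∧ (∀ a ∈ J, d a ∈ J) ∧ I ≤ J} := by
  refine le_antisymm (le_sInf fun J hJ ↦ hJ.2.2) fun f hf ↦ ?_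
  by_contra hfI
  obtain ⟨J, hIJ, hJ⟩ :=
    Ideal.exists_le_maximal_radical_differential d (Ideal.radical_eq_iff.1 hI_rad) hI_diff hfI
  exact hJ.prop.2.2 (Ideal.mem_sInf.1 hf
    ⟨Ideal.isPrime_of_maximal_radical_differential hd_mul hJ, hJ.prop.2.1, hIJ⟩)
end

section
/- Let k ⊆ K be differential fields of characteristic zero, where the derivation d of K restricts to the derivation of k, and let C_k and C_K denote their fields of constants. If elements f₁, …, fₙ of k are linearly independent over C_k, then they remain linearly independent over C_K when regarded as elements of K. -/
/-- The subfield of constants of a derivation on a field. -/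
def Derivation.constantSubfield {K : Type*} [Field K] (D : Derivation ℤ K K) : Subfield K where
  carrier := {x | D x = 0}
  zero_mem' := D.map_zero
  one_mem' := D.map_one_eq_zero
  add_mem' {a b} ha hb := by simp_all
  mul_mem' {a b} ha hb := by simp_all
  neg_mem' {a} ha := by simp_all
  inv_mem' a ha := by simp_all [D.leibniz_inv]

theorem Derivation.mem_constantSubfield {K : Type*} [Field K] {D : Derivation ℤ K K} {x : K} :
    x ∈ D.constantSubfield ↔ D x = 0 := Iff.rfl

/-- Constants that are linearly independent over the constants of a differential subfield `k`
are linearly independent over `k`. -/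
theorem Derivation.eq_zero_of_sum_constants_mul_eq_zero {K : Type*} [Field K]
    (D : Derivation ℤ K K) (k : Subfield K) (hk : ∀ a ∈ k, D a ∈ k)
    {ι : Type*} {e : ι → K} (he : ∀ j, D (e j) = 0)
    (hli : LinearIndependent ↥(D.constantSubfield ⊓ k) e) (s : Finset ι) :
    ∀ g : ι → K, (∀ j, g j ∈ k) → ∑ j ∈ s, e j * g j = 0 → ∀ j ∈ s, g j = 0 := by
  classical
  induction s using Finset.induction_on with
  | empty => simp
  | insert a s ha ih =>
    intro g hg hsum
    by_cases hga : g a = 0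
    · rw [Finset.sum_insert ha, hga, mul_zero, zero_add] at hsum
      intro j hj
      obtain rfl | hj := Finset.mem_insert.mp hj
      · exact hga
      · exact ih g hg hsum j hj
    · exfalso
      have hmem (j : ι) : g j / g a ∈ k := div_mem (hg j) (hg a)
      have hnorm : ∑ j ∈ insert a s, e j * (g j / g a) = 0 := by
        simp_rw [← mul_div_assoc, ← Finset.sum_div, hsum, zero_div]
      have hderiv : ∑ j ∈ s, e j * D (g j / g a) = 0 := by
        have h := congrArg D hnorm
        rw [Finset.sum_insert ha, div_self hga] at h
        simpa only [map_add, map_sum, Derivation.leibniz, he, smul_eq_mul, mul_zero, add_zero,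
          zero_add, D.map_one_eq_zero, map_zero] using h
      have hzero := ih (fun j => D (g j / g a)) (fun j => hk _ (hmem j)) hderiv
      have hconst (j : ι) (hj : j ∈ insert a s) :
          g j / g a ∈ D.constantSubfield ⊓ k := by
        refine ⟨?_, hmem j⟩
        obtain rfl | hj := Finset.mem_insert.mp hj
        · rw [div_self hga]
          exact one_mem D.constantSubfield
        · exact hzero j hj
      let h (j : ι) : ↥(D.constantSubfield ⊓ k) :=
        if hj : j ∈ insert a s then ⟨g j / g a, hconst j hj⟩ else 0
      have hrel : ∑ j ∈ insert a s, h j • e j = 0 := by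
        rw [← hnorm]
        refine Finset.sum_congr rfl fun j hj => ?_
        simp only [h, dif_pos hj, Subfield.smul_def, smul_eq_mul, mul_comm]
      have h_one := linearIndependent_iff'.mp hli _ h hrel a (Finset.mem_insert_self a s)
      rw [Subtype.ext_iff] at h_one
      simp [h, hga] at h_one

/-- A finite family of vectors can be expanded in a linearly independent finite family lying in
its span. -/
theorem exists_linearIndependent_expansion (F : Type*) {V ι : Type*} [Field F] [AddCommGroup V]
    [Module F V] [Finite ι] (c : ι → V) :
    ∃ (m : ℕ) (e : Fin m → V) (a : ι → Fin m → F), LinearIndependent F e ∧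
      (∀ j, e j ∈ Submodule.span F (Set.range c)) ∧ ∀ i, c i = ∑ j, a i j • e j := by
  let M : Submodule F V := Submodule.span F (Set.range c)
  have : FiniteDimensional F M := FiniteDimensional.span_of_finite F (Set.finite_range c)
  let b := Module.finBasis F M
  let v (i : ι) : M := ⟨c i, Submodule.subset_span ⟨i, rfl⟩⟩
  refine ⟨_, fun j => b j, fun i => b.repr (v i),
    b.linearIndependent.map' M.subtype M.ker_subtype, fun j => (b j).2, fun i => ?_⟩
  have h := congrArg M.subtype (b.sum_repr (v i))
  rw [map_sum] at h
  exact h.symm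

/-- Linear independence over constants is preserved in differential field extensions:
if `f₁, …, fₙ ∈ k` are linearly independent over the constants of `k`, then they are
linearly independent over the constants of any differential extension field `K`. -/
theorem linearIndependent_over_constants_of_extension
    {K : Type*} [Field K] [CharZero K] (d : K → K)
    (hd_add : ∀ a b : K, d (a + b) = d a + d b)
    (hd_mul : ∀ a b : K, d (a * b) = a * d b + d a * b)
    (k : Subfield K) (hk : ∀ a ∈ k, d a ∈ k)
    {n : ℕ} (f : Fin n → K) (hf : ∀ i, f i ∈ k)
    (hindep : ∀ c : Fin n → K,
      (∀ i, c i ∈ k ∧ d (c i) = 0) → ∑ i, c i * f i = 0 → c = 0) :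
    ∀ c : Fin n → K, (∀ i, d (c i) = 0) → ∑ i, c i * f i = 0 → c = 0 := by
  intro c hc hsum
  let D : Derivation ℤ K K := Derivation.mk' (AddMonoidHom.mk' d hd_add).toIntLinearMap
    fun a b => by simp [hd_mul, mul_comm]
  let F := D.constantSubfield ⊓ k
  obtain ⟨m, e, a, he, hspan, hexp⟩ := exists_linearIndependent_expansion F c
  have hconst (x : K) (hx : x ∈ Submodule.span F (Set.range c)) : D x = 0 := by
    induction hx using Submodule.span_induction with
    | mem x hx =>
      obtain ⟨i, rfl⟩ := hx
      exact hc i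
    | zero => exact D.map_zero
    | add x y _ _ hx hy => rw [map_add, hx, hy, add_zero]
    | smul a x _ hx => exact mul_mem (s := D.constantSubfield) a.2.1 hx
  have hcoord (j : Fin m) : ∑ i, (a i j : K) * f i = 0 := by
    refine D.eq_zero_of_sum_constants_mul_eq_zero k hk (fun j => hconst _ (hspan j)) he
      Finset.univ (fun j => ∑ i, (a i j : K) * f i)
      (fun j => sum_mem fun i _ => mul_mem (a i j).2.2 (hf i)) ?_ j (Finset.mem_univ j)
    rw [← hsum]
    simp_rw [Finset.mul_sum]
    rw [Finset.sum_comm]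
    refine Finset.sum_congr rfl fun i _ => ?_
    rw [hexp i, Finset.sum_mul]
    refine Finset.sum_congr rfl fun j _ => ?_
    rw [Subfield.smul_def, smul_eq_mul, mul_left_comm, mul_assoc, mul_left_comm]
  have hzero (j : Fin m) := hindep (fun i => (a i j : K))
    (fun i => ⟨(a i j).2.2, (a i j).2.1⟩) (hcoord j)
  funext i
  rw [hexp i]
  refine Finset.sum_eq_zero fun j _ => ?_
  rw [Subfield.smul_def, smul_eq_mul]
  exact mul_eq_zero_of_left (congrFun (hzero j) i) _
end

section
/- Let k be a differential field of characteristic zero with derivation d whose field of constants C is algebraically closed. Let R be a commutative differential k-algebra (its derivation extends d) that is finitely generated as a k-algebra and is d-simple, i.e., its only differential ideals are (0) and R. Then every element a ∈ R with d(a) = 0 lies in C. -/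
open Polynomial in
/-- If multiplication by every nonzero polynomial in `a` is injective on the nontrivial finitely
generated `k`-algebra `R`, then `a - c` is a nonunit for all but finitely many `c : k`. -/
theorem exists_forall_not_isRoot_not_isUnit_sub {k R : Type*} [Field k] [CommRing R] [Nontrivial R]
    [Algebra k R] [Algebra.FiniteType k R] (a : R)
    (ha : ∀ (p : k[X]) (r : R), p ≠ 0 → aeval a p * r = 0 → r = 0) :
    ∃ g : k[X], g ≠ 0 ∧ ∀ c : k, ¬ g.IsRoot c → ¬ IsUnit (a - algebraMap k R c) := by
  let : Algebra k[X] R := (aeval a : k[X] →ₐ[k] R).toRingHom.toAlgebra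
  have hmap (p : k[X]) : algebraMap k[X] R p = aeval a p := rfl
  have : IsScalarTower k k[X] R := .of_algebraMap_eq fun c => by
    rw [hmap, Polynomial.algebraMap_eq, aeval_C]
  have : Module.IsTorsionFree k[X] R := by
    refine Module.isTorsionFree_iff_smul_eq_zero.2 fun p r h => or_iff_not_imp_left.2 fun hp => ?_
    exact ha p r hp (by rwa [Algebra.smul_def, hmap] at h)
  have : Algebra.FiniteType k[X] R := .of_restrictScalars_finiteType k k[X] R
  have : Algebra.FinitePresentation k[X] R := Algebra.FinitePresentation.of_finiteType.1 ‹_›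
  have hopen := (PrimeSpectrum.isOpenMap_comap_of_hasGoingDown_of_finitePresentation
    (R := k[X]) (S := R)).isOpen_range
  obtain ⟨x⟩ : Nonempty (PrimeSpectrum R) := inferInstance
  obtain ⟨_, ⟨g, rfl⟩, hxg, hsub⟩ := PrimeSpectrum.isTopologicalBasis_basic_opens
    |>.exists_subset_of_mem_open (Set.mem_range_self x) hopen
  refine ⟨g, ?_, fun c hc hu => ?_⟩
  · rintro rfl
    simp at hxg
  · let P : PrimeSpectrum k[X] := ⟨Ideal.span {X - C c},
      (Ideal.span_singleton_prime (X_sub_C_ne_zero c)).2 (prime_X_sub_C c)⟩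
    obtain ⟨Q, hQ⟩ := hsub (show P ∈ PrimeSpectrum.basicOpen g from fun hg =>
      hc (dvd_iff_isRoot.1 (Ideal.mem_span_singleton.1 hg)))
    have hmem : X - C c ∈ (PrimeSpectrum.comap (algebraMap k[X] R) Q).asIdeal := by
      rw [hQ]
      exact Ideal.mem_span_singleton_self _
    rw [PrimeSpectrum.comap_asIdeal, Ideal.mem_comap, hmap, map_sub, aeval_X, aeval_C] at hmem
    exact Q.isPrime.ne_top (Ideal.eq_top_of_isUnit_mem _ hmem hu)

open Polynomial Differential in
/-- In a `d`-simple differential algebra, a nonzero polynomial in a transcendental constant is a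
nonzerodivisor. -/
theorem eq_zero_of_aeval_mul_eq_zero_of_transcendental {k R : Type*} [Field k] [Differential k]
    [CommRing R] [Differential R] [Algebra k R] [DifferentialAlgebra k R]
    (hsimple : ∀ I : Ideal R, (∀ a ∈ I, a′ ∈ I) → I = ⊥ ∨ I = ⊤)
    {a : R} (ha : Transcendental k a) (hda : a′ = 0) {p : k[X]} {r : R} (hp : p ≠ 0)
    (hr : aeval a p * r = 0) : r = 0 := by
  let I : Ideal R :=
    { carrier := {r | ∃ p : k[X], p ≠ 0 ∧ aeval a p * r = 0}
      zero_mem' := ⟨1, one_ne_zero, mul_zero _⟩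
      add_mem' := by
        rintro r s ⟨p, hp, hpr⟩ ⟨q, hq, hqs⟩
        refine ⟨p * q, mul_ne_zero hp hq, ?_⟩
        rw [map_mul]
        linear_combination aeval a q * hpr + aeval a p * hqs
      smul_mem' := by
        rintro s r ⟨p, hp, hpr⟩
        refine ⟨p, hp, ?_⟩
        rw [smul_eq_mul]
        linear_combination s * hpr }
  have hI : ∀ r ∈ I, r′ ∈ I := by
    rintro r ⟨p, hp, hpr⟩
    refine ⟨p * p, mul_ne_zero hp hp, ?_⟩
    have h := congrArg (fun x : R => x′) hpr
    simp only [Derivation.leibniz, deriv_aeval_eq, hda, mul_zero, add_zero, map_zero,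
      smul_eq_mul] at h
    rw [map_mul]
    linear_combination aeval a p * h - aeval a (mapCoeffs p) * hpr
  rcases hsimple I hI with h | h
  · have : r ∈ I := ⟨p, hp, hr⟩
    rwa [h, Ideal.mem_bot] at this
  · obtain ⟨q, hq, hq1⟩ : (1 : R) ∈ I := h ▸ Submodule.mem_top
    exact absurd (by rwa [mul_one] at hq1) (transcendental_iff.1 ha q |>.mt hq)

open Polynomial Differential in
/-- The minimal polynomial of an integral constant has constant coefficients. -/
theorem mapCoeffs_minpoly_eq_zero {k R : Type*} [Field k] [Differential k]
    [CommRing R] [Differential R] [Algebra k R] [DifferentialAlgebra k R]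
    {a : R} (ha : IsIntegral k a) (hda : a′ = 0) : mapCoeffs (minpoly k a) = 0 := by
  by_contra hne
  have haev : aeval a (mapCoeffs (minpoly k a)) = 0 := by
    have h := deriv_aeval_eq a (minpoly k a)
    rwa [minpoly.aeval, hda, mul_zero, add_zero, map_zero, eq_comm] at h
  refine (minpoly.degree_le_of_ne_zero k a hne haev).not_gt ?_
  rw [degree_eq_natDegree (minpoly.ne_zero ha), degree_lt_iff_coeff_zero]
  intro m hm
  rw [coeff_mapCoeffs]
  rcases hm.eq_or_lt with rfl | hm
  · rw [(minpoly.monic ha).coeff_natDegree, Derivation.map_one_eq_zero]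
  · rw [coeff_eq_zero_of_natDegree_lt hm, map_zero]

open Polynomial Differential in
/-- Constants of a finitely generated `d`-simple differential algebra over a differential field
with algebraically closed field of constants. -/
theorem exists_eq_algebraMap_of_deriv_eq_zero {k R : Type*} [Field k] [CharZero k] [Differential k]
    [CommRing R] [Nontrivial R] [Differential R] [Algebra k R] [DifferentialAlgebra k R]
    [Algebra.FiniteType k R]
    (hC : ∀ p : k[X], (∀ i, (p.coeff i)′ = 0) → 0 < p.degree → ∃ c : k, c′ = 0 ∧ p.IsRoot c)
    (hsimple : ∀ I : Ideal R, (∀ a ∈ I, a′ ∈ I) → I = ⊥ ∨ I = ⊤)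
    {a : R} (hda : a′ = 0) : ∃ c : k, c′ = 0 ∧ a = algebraMap k R c := by
  have hunit (c : k) (hc : c′ = 0) (hne : a ≠ algebraMap k R c) :
      IsUnit (a - algebraMap k R c) := by
    have hI : ∀ r ∈ Ideal.span {a - algebraMap k R c}, r′ ∈ Ideal.span {a - algebraMap k R c} := by
      intro r hr
      obtain ⟨s, rfl⟩ := Ideal.mem_span_singleton'.1 hr
      refine Ideal.mem_span_singleton'.2 ⟨s′, ?_⟩
      simp [Derivation.leibniz, hda, deriv_algebraMap, hc, mul_comm]
    rcases hsimple _ hI with h | h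
    · exact absurd (sub_eq_zero.1 (Ideal.span_singleton_eq_bot.1 h)) hne
    · exact Ideal.span_singleton_eq_top.1 h
  by_cases halg : IsAlgebraic k a
  · have hint := halg.isIntegral
    obtain ⟨c, hc, hroot⟩ := hC (minpoly k a)
      (fun i => by rw [← coeff_mapCoeffs, mapCoeffs_minpoly_eq_zero hint hda, coeff_zero])
      (minpoly.degree_pos hint)
    refine ⟨c, hc, by_contra fun hne => ?_⟩
    obtain ⟨q, hq⟩ := dvd_iff_isRoot.2 hroot
    have hq0 : q ≠ 0 := by
      rintro rfl
      exact minpoly.ne_zero hint (by rw [hq, mul_zero])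
    have hqa : aeval a q = 0 := by
      have h := minpoly.aeval k a
      rw [hq, map_mul, map_sub, aeval_X, aeval_C] at h
      exact (hunit c hc hne).mul_right_eq_zero.1 h
    refine (minpoly.degree_le_of_ne_zero k a hq0 hqa).not_gt ?_
    rw [hq, degree_mul, degree_X_sub_C, degree_eq_natDegree hq0]
    norm_cast
    omega
  · obtain ⟨g, hg, h⟩ := exists_forall_not_isRoot_not_isUnit_sub (k := k) a fun p r hp hr =>
      eq_zero_of_aeval_mul_eq_zero_of_transcendental hsimple halg hda hp hr
    obtain ⟨n, hn⟩ : ∃ n : ℕ, ¬ g.IsRoot (n : k) := by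
      by_contra! hall
      exact hg (eq_zero_of_infinite_isRoot g
        ((Set.infinite_range_of_injective Nat.cast_injective).mono (Set.range_subset_iff.2 hall)))
    refine absurd (hunit n (Derivation.map_natCast _ n) fun hne => halg ?_) (h n hn)
    exact hne ▸ isAlgebraic_algebraMap _

/-- Let `k` be a differential field of characteristic zero whose field of constants `C`
is algebraically closed (expressed as: every nonconstant polynomial with constant
coefficients has a constant root).  If `R` is a finitely generated differential
`k`-algebra that is `d`-simple, then every constant of `R` lies in `C`. -/
theorem constants_of_simple_differential_algebra
    {k : Type*} [Field k] [CharZero k] (dk : k → k)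
    (hdk_add : ∀ a b : k, dk (a + b) = dk a + dk b)
    (hdk_mul : ∀ a b : k, dk (a * b) = a * dk b + dk a * b)
    (hC_algClosed : ∀ p : Polynomial k, (∀ i, dk (p.coeff i) = 0) → 0 < p.degree →
      ∃ c : k, dk c = 0 ∧ p.IsRoot c)
    {R : Type*} [CommRing R] [Algebra k R] [Algebra.FiniteType k R]
    (dR : R → R)
    (hdR_add : ∀ a b : R, dR (a + b) = dR a + dR b)
    (hdR_mul : ∀ a b : R, dR (a * b) = a * dR b + dR a * b)
    (hext : ∀ a : k, dR (algebraMap k R a) = algebraMap k R (dk a))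
    (hsimple : ∀ I : Ideal R, (∀ a ∈ I, dR a ∈ I) → I = ⊥ ∨ I = ⊤) :
    ∀ a : R, dR a = 0 → ∃ c : k, dk c = 0 ∧ a = algebraMap k R c := by
  intro a ha
  let Dk : Derivation ℤ k k := .mk' (AddMonoidHom.mk' dk hdk_add).toIntLinearMap fun a b =>
    (hdk_mul a b).trans (by simp [mul_comm])
  let DR : Derivation ℤ R R := .mk' (AddMonoidHom.mk' dR hdR_add).toIntLinearMap fun a b =>
    (hdR_mul a b).trans (by simp [mul_comm])
  let : Differential k := ⟨Dk⟩
  let : Differential R := ⟨DR⟩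
  have : DifferentialAlgebra k R := ⟨hext⟩
  rcases subsingleton_or_nontrivial R with _ | _
  · exact ⟨0, Dk.map_zero, Subsingleton.elim _ _⟩
  · exact exists_eq_algebraMap_of_deriv_eq_zero hC_algClosed hsimple ha
end

section
/- Let k be a differential field of characteristic zero with derivation d whose field of constants is exactly C, and let S be any commutative C-algebra. Endow R = k ⊗_C S with the unique derivation D satisfying D(a ⊗ s) = d(a) ⊗ s for a ∈ k, s ∈ S. Then the map sending an ideal I of S to the ideal of R generated by the image of I is a bijection from the set of all ideals of S onto the set of all D-stable ideals of R, and its inverse sends a D-stable ideal J of R to {s ∈ S | 1 ⊗ s ∈ J}. -/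
open scoped TensorProduct

/-- A `D`-stable `k`-subspace contains no nonzero combination of vectors `v i` on which `D` acts
coefficientwise, as soon as it contains no such combination with constant coefficients. -/
theorem Finsupp.eq_zero_of_linearCombination_mem_of_derivation_stable
    {C k M ι : Type*} [Field C] [Field k] [Algebra C k] [AddCommGroup M] [Module k M]
    (d : k → k) (hd0 : d 0 = 0) (hd1 : d 1 = 0)
    (hconst : ∀ a : k, d a = 0 → a ∈ (algebraMap C k).range)
    (D : M → M) (v : ι → M) (J : Submodule k M) (hJ : ∀ x ∈ J, D x ∈ J)
    (hD : ∀ f : ι →₀ k, D (linearCombination k v f) = linearCombination k v (f.mapRange d hd0))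
    (hv : ∀ c : ι →₀ C, linearCombination k v
      (c.mapRange (algebraMap C k) (map_zero _)) ∈ J → c = 0)
    (f : ι →₀ k) (hf : linearCombination k v f ∈ J) : f = 0 := by
  classical
  induction hn : f.support.card using Nat.strong_induction_on generalizing f with
  | _ n ih =>
    by_contra hne
    obtain ⟨i, hi⟩ := Finsupp.support_nonempty_iff.mpr hne
    have hi0 : f i ≠ 0 := Finsupp.mem_support_iff.mp hi
    set g : ι →₀ k := (f i)⁻¹ • f with hg
    have hgJ : linearCombination k v g ∈ J := by
      rw [hg, map_smul]
      exact J.smul_mem _ hf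
    have hgi : g i = 1 := by simp [hg, hi0]
    have hlt : (g.mapRange d hd0).support.card < n := by
      rw [← hn]
      refine Finset.card_lt_card (Finset.ssubset_iff_of_subset ?_ |>.mpr ⟨i, hi, ?_⟩)
      · exact (Finsupp.support_mapRange).trans Finsupp.support_smul
      · simp [hgi, hd1]
    have hdg : g.mapRange d hd0 = 0 := ih _ hlt _ (hD g ▸ hJ _ hgJ) rfl
    have hgc (j : ι) : ∃ c : C, algebraMap C k c = g j :=
      hconst _ (by simpa using DFunLike.congr_fun hdg j)
    choose c hc using hgc
    let c' : ι →₀ C := Finsupp.onFinset g.support c fun j hj => by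
      rw [Finsupp.mem_support_iff, ← hc j]
      simpa using hj
    have hcg : c'.mapRange (algebraMap C k) (map_zero _) = g := by
      ext j
      simp [c', hc]
    have hc0 : c' = 0 := hv c' (hcg ▸ hgJ)
    rw [hc0, Finsupp.mapRange_zero] at hcg
    simp [← hcg] at hgi

/-- Contraction along `S → k ⊗[C] S` is left inverse to extension of ideals. -/
theorem Ideal.comap_map_includeRight {C k S : Type*} [Field C] [Field k] [Algebra C k]
    [CommRing S] [Algebra C S] (I : Ideal S) :
    Ideal.comap (Algebra.TensorProduct.includeRight : S →ₐ[C] k ⊗[C] S)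
      (Ideal.map (Algebra.TensorProduct.includeRight : S →ₐ[C] k ⊗[C] S) I) = I := by
  let : Algebra S (k ⊗[C] S) := Algebra.TensorProduct.rightAlgebra
  have : Module.FaithfullyFlat S (k ⊗[C] S) :=
    .of_linearEquiv _ _ (Algebra.TensorProduct.commRight C S k).toLinearEquiv.symm
  exact Ideal.comap_map_eq_self_of_faithfullyFlat (B := k ⊗[C] S) I

/-- Let `k` be a differential field of characteristic zero whose field of constants is
exactly `C`, and let `S` be a commutative `C`-algebra.  Endow `R = k ⊗[C] S` with the
unique (additive) map `D` with `D(a ⊗ s) = d(a) ⊗ s`.  Then `I ↦ I·R` is a bijection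
from the ideals of `S` onto the `D`-stable ideals of `R`, with inverse
`J ↦ {s | 1 ⊗ s ∈ J}`. -/
theorem ideal_bijection_constants_tensor
    {C k : Type*} [Field C] [Field k] [CharZero k] [Algebra C k]
    (d : k → k)
    (hd_add : ∀ a b : k, d (a + b) = d a + d b)
    (hd_mul : ∀ a b : k, d (a * b) = a * d b + d a * b)
    (hconst : ∀ a : k, d a = 0 ↔ a ∈ (algebraMap C k).range)
    {S : Type*} [CommRing S] [Algebra C S]
    (D : k ⊗[C] S → k ⊗[C] S)
    (hD_add : ∀ x y, D (x + y) = D x + D y)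
    (hD_tmul : ∀ (a : k) (s : S), D (a ⊗ₜ[C] s) = d a ⊗ₜ[C] s) :
    (∀ I : Ideal S, ∀ x ∈ Ideal.map (Algebra.TensorProduct.includeRight : S →ₐ[C] k ⊗[C] S) I,
        D x ∈ Ideal.map (Algebra.TensorProduct.includeRight : S →ₐ[C] k ⊗[C] S) I) ∧
    (∀ I : Ideal S,
        Ideal.comap (Algebra.TensorProduct.includeRight : S →ₐ[C] k ⊗[C] S)
          (Ideal.map (Algebra.TensorProduct.includeRight : S →ₐ[C] k ⊗[C] S) I) = I) ∧
    (∀ J : Ideal (k ⊗[C] S), (∀ x ∈ J, D x ∈ J) →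
        Ideal.map (Algebra.TensorProduct.includeRight : S →ₐ[C] k ⊗[C] S)
          (Ideal.comap (Algebra.TensorProduct.includeRight : S →ₐ[C] k ⊗[C] S) J) = J) := by
  have hd0 : d 0 = 0 := by simpa using hd_add 0 0
  have hd1 : d 1 = 0 := by simpa using hd_mul 1 1
  have hD0 : D 0 = 0 := by simpa using hD_add 0 0
  refine ⟨fun I x hx => ?_, Ideal.comap_map_includeRight, fun J hJ => ?_⟩
  · have hD_mul (r : k ⊗[C] S) (s : S) : D (r * 1 ⊗ₜ[C] s) = D r * 1 ⊗ₜ[C] s := by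
      induction r using TensorProduct.induction_on with
      | zero => simp [hD0]
      | tmul a t => simp [hD_tmul]
      | add x y hx hy => rw [add_mul, hD_add, hD_add, hx, hy, add_mul]
    rw [Ideal.map] at hx
    induction hx using Submodule.closure_induction with
    | zero => rw [hD0]; exact zero_mem _
    | add x y _ _ hx hy => rw [hD_add]; exact add_mem hx hy
    | smul_mem r x hx =>
      obtain ⟨s, hs, rfl⟩ := hx
      have h := hD_mul r s
      rw [smul_eq_mul]
      exact h ▸ Ideal.mul_mem_left _ _ (Ideal.mem_map_of_mem _ hs)
  · refine le_antisymm Ideal.map_comap_le fun x hx => ?_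
    let I : Ideal S :=
      Ideal.comap (Algebra.TensorProduct.includeRight : S →ₐ[C] k ⊗[C] S) J
    have hIJ : Ideal.map (Algebra.TensorProduct.includeRight : S →ₐ[C] k ⊗[C] S) I ≤ J :=
      Ideal.map_comap_le
    let b := Module.Basis.ofVectorSpace C (S ⧸ I)
    choose e he using fun i => Ideal.Quotient.mk_surjective (I := I) (b i)
    have hmk (c : _ →₀ C) : Ideal.Quotient.mk I (Finsupp.linearCombination C e c) =
        Finsupp.linearCombination C b c := by
      rw [← Ideal.Quotient.mkₐ_eq_mk C I, ← AlgHom.toLinearMap_apply,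
        Finsupp.apply_linearCombination]
      congr 2
      exact funext he
    have hconst_comb (a : k) (c : _ →₀ C) : a ⊗ₜ[C] Finsupp.linearCombination C e c =
        Finsupp.linearCombination k (fun i => (1 : k) ⊗ₜ[C] e i)
          (a • c.mapRange (algebraMap C k) (map_zero _)) := by
      induction c using Finsupp.induction_linear with
      | zero => simp
      | add c c' hc hc' =>
        rw [map_add, TensorProduct.tmul_add, hc, hc', Finsupp.mapRange_add (map_add _), smul_add,
          map_add]
      | single i c =>
        rw [Finsupp.mapRange_single, Finsupp.smul_single, Finsupp.linearCombination_single,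
          Finsupp.linearCombination_single, TensorProduct.smul_tmul', ← TensorProduct.smul_tmul]
        simp [Algebra.smul_def, mul_comm]
    have hdecomp (y : k ⊗[C] S) : ∃ f,
        y - Finsupp.linearCombination k (fun i => (1 : k) ⊗ₜ[C] e i) f ∈
          Ideal.map (Algebra.TensorProduct.includeRight : S →ₐ[C] k ⊗[C] S) I := by
      induction y using TensorProduct.induction_on with
      | zero => exact ⟨0, by simp⟩
      | tmul a s =>
        refine ⟨a • (b.repr (Ideal.Quotient.mk I s)).mapRange (algebraMap C k) (map_zero _), ?_⟩
        have hs : s - Finsupp.linearCombination C e (b.repr (Ideal.Quotient.mk I s)) ∈ I := by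
          rw [← Ideal.Quotient.eq, hmk, b.linearCombination_repr]
        have h := Ideal.mul_mem_left _ (a ⊗ₜ[C] (1 : S)) (Ideal.mem_map_of_mem
          (Algebra.TensorProduct.includeRight : S →ₐ[C] k ⊗[C] S) hs)
        rw [← hconst_comb, ← TensorProduct.tmul_sub]
        simpa using h
      | add y z hy hz =>
        obtain ⟨f, hf⟩ := hy
        obtain ⟨g, hg⟩ := hz
        refine ⟨f + g, ?_⟩
        rw [map_add, add_sub_add_comm]
        exact add_mem hf hg
    obtain ⟨f, hf⟩ := hdecomp x
    have hfJ : Finsupp.linearCombination k (fun i => (1 : k) ⊗ₜ[C] e i) f ∈ J :=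
      (Submodule.sub_mem_iff_right J hx).mp (hIJ hf)
    have hf0 : f = 0 := by
      refine Finsupp.eq_zero_of_linearCombination_mem_of_derivation_stable d hd0 hd1
        (fun a => (hconst a).mp) D _ (J.restrictScalars k) hJ (fun g => ?_) (fun c hc => ?_) f hfJ
      · induction g using Finsupp.induction_linear with
        | zero => simp [hD0]
        | add g h hg hh =>
          rw [map_add, hD_add, hg, hh, Finsupp.mapRange_add hd_add, map_add]
        | single i a => simp [TensorProduct.smul_tmul', hD_tmul]
      · have h1 := hconst_comb 1 c
        rw [one_smul] at h1
        rw [← h1] at hc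
        have hcI : Finsupp.linearCombination C e c ∈ I := hc
        rw [← Ideal.Quotient.eq_zero_iff_mem, hmk] at hcI
        exact linearIndependent_iff.mp b.linearIndependent c hcI
    simpa [hf0] using hf
end

section
/- Let k be a differential field of characteristic zero with derivation d and let A be an n×n matrix over k. Then there exists a Picard–Vessiot ring R for the equation d(Y) = A·Y over k, and any such Picard–Vessiot ring is an integral domain. -/
/-- `R` (with derivation `dR`) is a Picard–Vessiot ring for the equation `d(Y) = A·Y`
over the differential field `(k, dk)`: the derivation `dR` extends `dk`, `R` is
`d`-simple, and `R` is generated over `k` by the entries of an invertible fundamental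
solution matrix `Z` together with the inverse of `det Z`. -/
def IsPicardVessiotRing {k : Type*} [Field k] {n : Type*} [Fintype n] [DecidableEq n]
    (dk : k → k) (A : Matrix n n k)
    (R : Type*) [CommRing R] [Algebra k R] (dR : R → R) : Prop :=
  (∀ a b : R, dR (a + b) = dR a + dR b) ∧
  (∀ a b : R, dR (a * b) = a * dR b + dR a * b) ∧
  (∀ a : k, dR (algebraMap k R a) = algebraMap k R (dk a)) ∧
  ((⊥ : Ideal R) ≠ ⊤) ∧
  (∀ I : Ideal R, (∀ a ∈ I, dR a ∈ I) → I = ⊥ ∨ I = ⊤) ∧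
  (∃ (Z : Matrix n n R) (w : R),
    Z.det * w = 1 ∧
    Z.map dR = A.map (algebraMap k R) * Z ∧
    Algebra.adjoin k ((Set.range fun p : n × n => Z p.1 p.2) ∪ {w}) = ⊤)

open Finset in
/-- The general Leibniz rule for iterated derivations. -/
theorem Derivation.iterate_apply_mul {S R : Type*} [CommSemiring S] [CommRing R] [Algebra S R]
    (D : Derivation S R R) (n : ℕ) (a b : R) :
    D^[n] (a * b) = ∑ ij ∈ antidiagonal n, n.choose ij.1 • (D^[ij.1] a * D^[ij.2] b) := by
  induction n with
  | zero => simp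
  | succ n ih =>
    rw [sum_antidiagonal_choose_succ_nsmul (M := R) (fun i j => D^[i] a * D^[j] b) n]
    simp only [Function.iterate_succ_apply', ih, map_sum, map_nsmul, Derivation.leibniz,
      smul_eq_mul, smul_add, sum_add_distrib, add_right_inj]
    refine sum_congr rfl fun ⟨i, j⟩ hij ↦ ?_
    rw [n.choose_symm_of_eq_add (mem_antidiagonal.1 hij).symm, mul_comm]

/-- The largest ideal inside `P` that is stable under the derivation `D`. -/
def Derivation.idealCore {S R : Type*} [CommSemiring S] [CommRing R] [Algebra S R]
    (D : Derivation S R R) (P : Ideal R) : Ideal R where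
  carrier := {x | ∀ n, D^[n] x ∈ P}
  zero_mem' n := by simp [iterate_map_zero]
  add_mem' ha hb n := by
    rw [iterate_map_add]
    exact P.add_mem (ha n) (hb n)
  smul_mem' c x hx n := by
    rw [smul_eq_mul, D.iterate_apply_mul]
    exact P.sum_mem fun ij _ ↦ nsmul_mem (P.mul_mem_left _ (hx _)) _

theorem Derivation.mem_idealCore {S R : Type*} [CommSemiring S] [CommRing R] [Algebra S R]
    {D : Derivation S R R} {P : Ideal R} {x : R} :
    x ∈ D.idealCore P ↔ ∀ n, D^[n] x ∈ P :=
  Iff.rfl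

theorem Derivation.apply_mem_idealCore {S R : Type*} [CommSemiring S] [CommRing R] [Algebra S R]
    {D : Derivation S R R} {P : Ideal R} {x : R} (hx : x ∈ D.idealCore P) :
    D x ∈ D.idealCore P :=
  fun n ↦ hx (n + 1)

open Finset in
/-- In a ring containing `ℚ`, the largest differential ideal inside a prime ideal is prime. -/
theorem Derivation.isPrime_idealCore {S R : Type*} [CommSemiring S] [CommRing R] [Algebra S R]
    [Algebra ℚ R] (D : Derivation S R R) (P : Ideal R) [hP : P.IsPrime] :
    (D.idealCore P).IsPrime := by
  classical
  refine ⟨fun h ↦ hP.ne_top ((Ideal.eq_top_iff_one _).2 ?_), fun {x y} hxy ↦ ?_⟩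
  · exact (Ideal.eq_top_iff_one _).1 h 0
  by_contra! hcon
  obtain ⟨hx, hy⟩ := hcon
  rw [mem_idealCore, not_forall] at hx hy
  set m := Nat.find hx with hm
  set l := Nat.find hy with hl
  have hmem := hxy (m + l)
  rw [D.iterate_apply_mul,
    ← add_sum_erase _ _ (HasAntidiagonal.mem_antidiagonal.2 (rfl : (m, l).1 + (m, l).2 = _))] at hmem
  have hrest : ∑ ij ∈ (antidiagonal (m + l)).erase (m, l),
      (m + l).choose ij.1 • (D^[ij.1] x * D^[ij.2] y) ∈ P := by
    refine P.sum_mem fun ⟨i, j⟩ hij ↦ nsmul_mem ?_ _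
    simp only [mem_erase, HasAntidiagonal.mem_antidiagonal, ne_eq, Prod.mk.injEq] at hij
    obtain h | h : i < m ∨ j < l := by omega
    · exact P.mul_mem_right _ (not_not.1 (Nat.find_min hx h))
    · exact P.mul_mem_left _ (not_not.1 (Nat.find_min hy h))
  have hlead := (P.add_mem_iff_left hrest).1 hmem
  have hchoose : ((m + l).choose m : ℚ) ≠ 0 :=
    Nat.cast_ne_zero.2 (Nat.choose_pos (Nat.le_add_right m l)).ne'
  have hunit : IsUnit (((m + l).choose m : ℕ) : R) := by
    simpa using (IsUnit.mk0 _ hchoose).map (algebraMap ℚ R)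
  rw [nsmul_eq_mul] at hlead
  obtain h | h := hP.mem_or_mem hlead
  · exact hP.ne_top (P.eq_top_of_isUnit_mem h hunit)
  · obtain h | h := hP.mem_or_mem h
    · exact Nat.find_spec hx h
    · exact Nat.find_spec hy h

/-- A differentially simple ring containing `ℚ` is an integral domain. -/
theorem Derivation.isDomain_of_simple {S R : Type*} [CommSemiring S] [CommRing R] [Algebra S R]
    [Algebra ℚ R] [Nontrivial R] (D : Derivation S R R)
    (hD : ∀ I : Ideal R, (∀ a ∈ I, D a ∈ I) → I = ⊥ ∨ I = ⊤) : IsDomain R := by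
  obtain ⟨P, hP⟩ := Ideal.exists_maximal R
  have := hP.isPrime
  have hprime := D.isPrime_idealCore P
  obtain h | h := hD (D.idealCore P) fun a ha ↦ apply_mem_idealCore ha
  · rw [h] at hprime
    exact IsDomain.of_bot_isPrime R
  · exact absurd h hprime.ne_top

/-- A derivation of `R` extends to polynomials over `R`, with prescribed values on the
variables. -/
theorem MvPolynomial.exists_derivation_extending {σ R : Type*} [CommRing R]
    (d : Derivation ℤ R R) (f : σ → MvPolynomial σ R) :
    ∃ D : Derivation ℤ (MvPolynomial σ R) (MvPolynomial σ R),
      (∀ a, D (C a) = C (d a)) ∧ ∀ i, D (X i) = f i := by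
  let φ₀ : R →+* TrivSqZeroExt (MvPolynomial σ R) (MvPolynomial σ R) :=
    { toFun a := TrivSqZeroExt.inl (C a) + TrivSqZeroExt.inr (C (d a))
      map_zero' := by simp
      map_one' := by simp
      map_add' a b := TrivSqZeroExt.ext (by simp) (by simp)
      map_mul' a b := TrivSqZeroExt.ext (by simp) (by simp [mul_comm]) }
  have hφ₀ (a : R) : φ₀ a = TrivSqZeroExt.inl (C a) + TrivSqZeroExt.inr (C (d a)) := rfl
  let φ := eval₂Hom φ₀ fun i ↦ TrivSqZeroExt.inl (X i) + TrivSqZeroExt.inr (f i)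
  have hfst : ∀ p, (φ p).fst = p := by
    have : (TrivSqZeroExt.fstHom ℤ (MvPolynomial σ R) (MvPolynomial σ R)).toRingHom.comp φ =
        RingHom.id _ := by
      refine ringHom_ext (fun r ↦ ?_) fun i ↦ ?_
      · simp [φ, hφ₀]
      · simp [φ]
    exact fun p ↦ RingHom.congr_fun this p
  refine ⟨Derivation.mk' (AddMonoidHom.toIntLinearMap
    { toFun p := (φ p).snd, map_zero' := by simp, map_add' := by simp }) fun p q ↦ ?_,
    fun a ↦ ?_, fun i ↦ ?_⟩
  · change (φ (p * q)).snd = p • (φ q).snd + q • (φ p).snd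
    rw [map_mul, TrivSqZeroExt.snd_mul, hfst, hfst, op_smul_eq_smul]
  · simp [φ, hφ₀]
  · simp [φ]

/-- Every proper differential ideal is contained in a maximal proper differential ideal. -/
theorem Derivation.exists_le_maximal_stable {S R : Type*} [CommSemiring S] [CommRing R]
    [Algebra S R] (D : Derivation S R R) {I : Ideal R} (hI : I ≠ ⊤) (hDI : ∀ a ∈ I, D a ∈ I) :
    ∃ J, I ≤ J ∧ Maximal (fun J : Ideal R ↦ J ≠ ⊤ ∧ ∀ a ∈ J, D a ∈ J) J := by
  refine zorn_le_nonempty₀ {J : Ideal R | J ≠ ⊤ ∧ ∀ a ∈ J, D a ∈ J} ?_ I ⟨hI, hDI⟩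
  intro c hc hchain J hJ
  have hdir : DirectedOn (· ≤ ·) c := hchain.directedOn
  refine ⟨sSup c, ⟨fun h ↦ ?_, fun a ha ↦ ?_⟩, fun K hK ↦ le_sSup hK⟩
  · rw [Ideal.eq_top_iff_one, Submodule.mem_sSup_of_directed ⟨J, hJ⟩ hdir] at h
    obtain ⟨K, hK, h1⟩ := h
    exact (hc hK).1 ((Ideal.eq_top_iff_one K).2 h1)
  · rw [Submodule.mem_sSup_of_directed ⟨J, hJ⟩ hdir] at ha ⊢
    obtain ⟨K, hK, haK⟩ := ha
    exact ⟨K, hK, (hc hK).2 a haK⟩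

/-- A derivation induces a map on the quotient by a differential ideal. -/
theorem Derivation.exists_quotient_map {S R : Type*} [CommSemiring S] [CommRing R]
    [Algebra S R] (D : Derivation S R R) {I : Ideal R} (hDI : ∀ a ∈ I, D a ∈ I) :
    ∃ d : R ⧸ I → R ⧸ I, ∀ a, d (Ideal.Quotient.mk I a) = Ideal.Quotient.mk I (D a) := by
  refine ⟨fun x ↦ Ideal.Quotient.mk I
    (D (Function.surjInv Ideal.Quotient.mk_surjective x)), fun a ↦ ?_⟩
  rw [Ideal.Quotient.eq, ← map_sub]
  refine hDI _ ((Ideal.Quotient.eq).1 ?_)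
  exact Function.surjInv_eq Ideal.Quotient.mk_surjective _

/-- The quotient by a maximal proper differential ideal is differentially simple. -/
theorem Derivation.quotient_simple_of_maximal {S R : Type*} [CommSemiring S] [CommRing R]
    [Algebra S R] {D : Derivation S R R} {I : Ideal R}
    (hI : Maximal (fun J : Ideal R ↦ J ≠ ⊤ ∧ ∀ a ∈ J, D a ∈ J) I) {d : R ⧸ I → R ⧸ I}
    (hd : ∀ a, d (Ideal.Quotient.mk I a) = Ideal.Quotient.mk I (D a))
    (J : Ideal (R ⧸ I)) (hJ : ∀ a ∈ J, d a ∈ J) : J = ⊥ ∨ J = ⊤ := by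
  have hle : I ≤ J.comap (Ideal.Quotient.mk I) := fun a ha ↦ by
    rw [Ideal.mem_comap, Ideal.Quotient.eq_zero_iff_mem.2 ha]
    exact J.zero_mem
  by_cases htop : J.comap (Ideal.Quotient.mk I) = ⊤
  · exact Or.inr ((Ideal.comap_eq_top_iff).1 htop)
  · left
    have hge := hI.2 ⟨htop, fun a ha ↦ by
      rw [Ideal.mem_comap, ← hd]
      exact hJ _ ha⟩ hle
    refine (Submodule.eq_bot_iff J).2 fun x hx ↦ ?_
    obtain ⟨a, rfl⟩ := Ideal.Quotient.mk_surjective x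
    exact Ideal.Quotient.eq_zero_iff_mem.2 (hge hx)

/-- Two derivations that agree on the entries of a matrix agree on its determinant. -/
theorem Derivation.apply_det_eq {S R n : Type*} [CommRing S] [CommRing R] [Algebra S R]
    [Fintype n] [DecidableEq n] (D₁ D₂ : Derivation S R R) (Z : Matrix n n R)
    (h : ∀ i j, D₁ (Z i j) = D₂ (Z i j)) :
    D₁ Z.det = D₂ Z.det := by
  refine Derivation.eqOn_adjoin (s := Set.range fun p : n × n ↦ Z p.1 p.2)
    (by rintro _ ⟨p, rfl⟩; exact h _ _) ?_
  rw [Matrix.det_apply]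
  refine Subalgebra.sum_mem _ fun τ _ ↦ ?_
  rw [Units.smul_def]
  exact zsmul_mem (Subalgebra.prod_mem _ fun i _ ↦
    Algebra.subset_adjoin (Set.mem_range_self (τ i, i))) _

/-- Every linear differential equation over a differential field has a Picard–Vessiot ring. -/
theorem exists_isPicardVessiotRing {k : Type u} [Field k] (dk : Derivation ℤ k k)
    {n : Type*} [Fintype n] [DecidableEq n] (A : Matrix n n k) :
    ∃ (R : Type u) (_ : CommRing R) (_ : Algebra k R) (dR : R → R),
      IsPicardVessiotRing dk A R dR := by
  let e := Fintype.equivFin n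
  let σ := Option (Fin (Fintype.card n) × Fin (Fintype.card n))
  let Z : Matrix n n (MvPolynomial σ k) := Matrix.of fun i j ↦ MvPolynomial.X (some (e i, e j))
  let w : MvPolynomial σ k := MvPolynomial.X none
  let B : Matrix n n (MvPolynomial σ k) := A.map MvPolynomial.C * Z
  let f (c : MvPolynomial σ k) (s : σ) : MvPolynomial σ k :=
    s.elim c fun p ↦ B (e.symm p.1) (e.symm p.2)
  obtain ⟨D₀, -, hD₀X⟩ := MvPolynomial.exists_derivation_extending dk (f 0)
  obtain ⟨D, hDC, hDX⟩ := MvPolynomial.exists_derivation_extending dk (f (-(w * w * D₀ Z.det)))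
  have hDZ (i j : n) : D (Z i j) = B i j := by simp [Z, hDX, f]
  have hD₀Z (i j : n) : D₀ (Z i j) = B i j := by simp [Z, hD₀X, f]
  have hDw : D w = -(w * w * D Z.det) := by
    have hdet : D Z.det = D₀ Z.det :=
      D.apply_det_eq D₀ Z fun i j ↦ (hDZ i j).trans (hD₀Z i j).symm
    rw [hdet]
    exact hDX none
  let g := Z.det * w - 1
  have hDg : ∀ a ∈ Ideal.span {g}, D a ∈ Ideal.span {g} := by
    intro a ha
    obtain ⟨b, rfl⟩ := Ideal.mem_span_singleton'.1 ha
    refine Ideal.mem_span_singleton'.2 ⟨D b - b * w * D Z.det, ?_⟩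
    simp only [g, Derivation.leibniz, map_sub, hDw, smul_eq_mul, Derivation.map_one_eq_zero]
    ring
  have hg : Ideal.span {g} ≠ ⊤ := by
    let ev : MvPolynomial σ k →+* k := MvPolynomial.eval
      fun s : σ ↦ s.elim 1 fun p ↦ (1 : Matrix _ _ k) p.1 p.2
    have hevZ : ev.mapMatrix Z = 1 := by
      ext i j
      simp [ev, Z, Matrix.one_apply]
    have hevg : ev g = 0 := by
      simp only [g, map_sub, map_mul, RingHom.map_det, hevZ]
      simp [ev, w]
    intro h
    have hle : Ideal.span {g} ≤ RingHom.ker ev := by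
      simpa [Ideal.span_le] using hevg
    exact RingHom.ker_ne_top ev (top_unique (h ▸ hle))
  obtain ⟨I, hgI, hI⟩ := D.exists_le_maximal_stable hg hDg
  obtain ⟨d, hd⟩ := D.exists_quotient_map hI.1.2
  have hmk := Ideal.Quotient.mk_surjective (I := I)
  refine ⟨MvPolynomial σ k ⧸ I, inferInstance, inferInstance, d, ?_, ?_, fun a ↦ ?_, ?_,
    D.quotient_simple_of_maximal hI hd, Z.map (Ideal.Quotient.mk I), Ideal.Quotient.mk I w,
    ?_, ?_, ?_⟩
  · refine hmk.forall₂.2 fun a b ↦ ?_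
    simp only [← map_add, hd]
  · refine hmk.forall₂.2 fun a b ↦ ?_
    rw [← map_mul, hd, hd, hd, ← map_mul, ← map_mul, ← map_add, Derivation.leibniz, smul_eq_mul,
      smul_eq_mul, mul_comm b]
  · exact (hd (MvPolynomial.C a)).trans (congrArg _ (hDC a))
  · have := Ideal.Quotient.nontrivial_iff.2 hI.1.1
    exact bot_ne_top
  · rw [← RingHom.mapMatrix_apply, ← RingHom.map_det, ← map_mul, ← sub_eq_zero,
      ← map_one (Ideal.Quotient.mk I), ← map_sub, Ideal.Quotient.eq_zero_iff_mem]
    exact hgI (Ideal.mem_span_singleton_self g)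
  · have hA : A.map (algebraMap k (MvPolynomial σ k ⧸ I)) =
        (A.map MvPolynomial.C).map (Ideal.Quotient.mk I) := rfl
    rw [hA, ← Matrix.map_mul]
    ext i j
    simp only [Matrix.map_apply, hd, hDZ, B]
  · have himage := congrArg (Subalgebra.map (Ideal.Quotient.mkₐ k I))
      (MvPolynomial.adjoin_range_X (σ := σ) (R := k))
    rw [AlgHom.map_adjoin, Algebra.map_top,
      (AlgHom.range_eq_top _).2 (Ideal.Quotient.mkₐ_surjective k I)] at himage
    refine top_unique (himage.ge.trans (Algebra.adjoin_mono ?_))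
    rintro _ ⟨_, ⟨s, rfl⟩, rfl⟩
    obtain _ | ⟨i, j⟩ := s
    · exact Or.inr rfl
    · exact Or.inl ⟨(e.symm i, e.symm j), by simp [Z]⟩

/-- Existence of Picard–Vessiot rings, and the fact that any Picard–Vessiot ring is
an integral domain. -/
theorem exists_picardVessiotRing_and_isDomain
    {k : Type u} [Field k] [CharZero k] (dk : k → k)
    (hdk_add : ∀ a b : k, dk (a + b) = dk a + dk b)
    (hdk_mul : ∀ a b : k, dk (a * b) = a * dk b + dk a * b)
    {n : Type*} [Fintype n] [DecidableEq n] (A : Matrix n n k) :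
    (∃ (R : Type u) (_ : CommRing R) (_ : Algebra k R) (dR : R → R),
        IsPicardVessiotRing dk A R dR) ∧
    (∀ (R : Type v) (_ : CommRing R) (_ : Algebra k R) (dR : R → R),
        IsPicardVessiotRing dk A R dR → IsDomain R) := by
  let d : Derivation ℤ k k := Derivation.mk'
    (AddMonoidHom.mk' dk hdk_add).toIntLinearMap fun a b ↦ by
      simp [hdk_mul, mul_comm]
  refine ⟨exists_isPicardVessiotRing d A, ?_⟩
  rintro R _ _ dR ⟨hadd, hmul, -, hne, hsimple, -⟩
  let D : Derivation ℤ R R := Derivation.mk'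
    (AddMonoidHom.mk' dR hadd).toIntLinearMap fun a b ↦ by
      simp [hmul, mul_comm]
  have : Nontrivial R := (Submodule.nontrivial_iff R).1 ⟨⊥, ⊤, hne⟩
  let _ : Algebra ℚ R := ((algebraMap k R).comp (algebraMap ℚ k)).toAlgebra
  exact D.isDomain_of_simple hsimple
end

section
/- Let k be a differential field of characteristic zero with derivation d whose field of constants C is algebraically closed, let A be an n×n matrix over k, and let R₁ and R₂ be two Picard–Vessiot rings for d(Y) = A·Y over k. Then there exists a k-algebra isomorphism φ : R₁ → R₂ that commutes with the derivations. -/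
open scoped Differential TensorProduct

/-- In a finitely generated algebra over a field, if `x - a` is a unit for infinitely many scalars
`a`, then `x` is algebraic. -/
theorem isAlgebraic_of_infinite_isUnit_sub {k R : Type*} [Field k] [CommRing R] [Algebra k R]
    [Algebra.FiniteType k R] (x : R)
    (hx : {a : k | IsUnit (x - algebraMap k R a)}.Infinite) : IsAlgebraic k x := by
  by_contra htr
  have hinj : Function.Injective (Polynomial.aeval (R := k) x) :=
    transcendental_iff_injective.mp htr
  let f : Polynomial k →+* R := (Polynomial.aeval (R := k) x).toRingHom
  have hf : f.FinitePresentation := by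
    rw [← RingHom.FinitePresentation.of_finiteType]
    refine RingHom.FiniteType.of_comp_finiteType (f := algebraMap k (Polynomial k)) ?_
    have hcomp : f.comp (algebraMap k (Polynomial k)) = algebraMap k R :=
      (Polynomial.aeval (R := k) x).comp_algebraMap
    rw [hcomp, RingHom.finiteType_algebraMap]
    infer_instance
  obtain ⟨S, hS⟩ := PrimeSpectrum.exists_constructibleSetData_iff.mpr
    (PrimeSpectrum.isConstructible_range_comap hf)
  have hbot : (⊥ : PrimeSpectrum (Polynomial k)) ∈ S.toSet := by
    rw [hS]
    obtain ⟨P, hP, hPc⟩ := Ideal.exists_comap_eq_of_mem_minimalPrimes_of_injective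
      (f := f) hinj ⊥ (by simp [IsDomain.minimalPrimes_eq_singleton_bot])
    exact ⟨⟨P, hP⟩, PrimeSpectrum.ext hPc⟩
  obtain ⟨B, hB, hbotB⟩ := Set.mem_iUnion₂.mp hbot
  have hg : ∀ i, B.g i = 0 := fun i ↦ by
    simpa using (PrimeSpectrum.mem_zeroLocus _ _).mp hbotB.1 ⟨i, rfl⟩
  have hBf : B.f ≠ 0 := fun h ↦ hbotB.2 <| by simp [h]
  obtain ⟨a, ha, haf⟩ : ∃ a, IsUnit (x - algebraMap k R a) ∧ ¬ B.f.IsRoot a := by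
    by_contra! hcon
    exact hBf (Polynomial.eq_zero_of_infinite_isRoot _ (hx.mono hcon))
  have hprime : (Ideal.span {Polynomial.X - Polynomial.C a}).IsPrime := by
    rw [Ideal.span_singleton_prime (Polynomial.X_sub_C_ne_zero a)]
    exact Polynomial.prime_X_sub_C a
  have hmem : (⟨_, hprime⟩ : PrimeSpectrum (Polynomial k)) ∈ S.toSet := by
    refine Set.mem_iUnion₂.mpr ⟨B, hB, ?_, ?_⟩
    · rintro _ ⟨i, rfl⟩
      simp [hg i]
    · intro h
      have := (PrimeSpectrum.mem_zeroLocus _ _).mp h (Set.mem_singleton _)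
      exact haf (Polynomial.dvd_iff_isRoot.mp (Ideal.mem_span_singleton.mp this))
  rw [hS] at hmem
  obtain ⟨P, hP⟩ := hmem
  have hxP : f (Polynomial.X - Polynomial.C a) ∈ P.asIdeal := by
    have h := congrArg PrimeSpectrum.asIdeal hP
    have h' : Polynomial.X - Polynomial.C a ∈ (PrimeSpectrum.comap f P).asIdeal := by
      rw [h]
      exact Ideal.mem_span_singleton_self _
    exact h'
  refine P.isPrime.ne_top (Ideal.eq_top_of_isUnit_mem _ hxP ?_)
  simpa [f] using ha

/-- A differential ring is differentially simple if its only differential ideals are `⊥`, `⊤`. -/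
def Differential.IsSimple (R : Type*) [CommRing R] [Differential R] : Prop :=
  ∀ I : Ideal R, (∀ a ∈ I, a′ ∈ I) → I = ⊥ ∨ I = ⊤

theorem Differential.IsSimple.isUnit_of_deriv_eq_zero {R : Type*} [CommRing R] [Differential R]
    (hR : Differential.IsSimple R) {c : R} (hc : c′ = 0) (hc0 : c ≠ 0) : IsUnit c := by
  rw [← Ideal.span_singleton_eq_top]
  refine (hR (Ideal.span {c}) fun a ha ↦ ?_).resolve_left (by simpa using hc0)
  obtain ⟨b, rfl⟩ := Ideal.mem_span_singleton.mp ha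
  rw [Derivation.leibniz, hc, smul_zero, add_zero, smul_eq_mul]
  exact Ideal.mem_span_singleton.mpr (dvd_mul_right _ _)

theorem Differential.IsSimple.injective {R S : Type*} [CommRing R] [Differential R] [CommRing S]
    [Nontrivial S] [Differential S] (hR : Differential.IsSimple R) (f : R →+* S)
    (hf : ∀ a, f a′ = (f a)′) : Function.Injective f := by
  rw [RingHom.injective_iff_ker_eq_bot]
  refine (hR _ fun a ha ↦ ?_).resolve_right (RingHom.ker_ne_top f)
  rw [RingHom.mem_ker] at ha ⊢
  rw [hf, ha, map_zero]

/-- The constants of a differentially simple, finitely generated algebra over a differential field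
with algebraically closed constants are the constants of the field. -/
theorem Differential.IsSimple.exists_algebraMap_eq {k R : Type*} [Field k] [CharZero k]
    [Differential k]
    (hk : ∀ p : Polynomial k, (∀ i, (p.coeff i)′ = 0) → 0 < p.degree →
      ∃ c : k, c′ = 0 ∧ p.IsRoot c)
    [CommRing R] [Nontrivial R] [Differential R] [Algebra k R] [DifferentialAlgebra k R]
    [Algebra.FiniteType k R] (hR : Differential.IsSimple R) {c : R} (hc : c′ = 0) :
    ∃ a : k, algebraMap k R a = c := by
  by_contra! hcon
  have hunit : ∀ a : k, a′ = 0 → IsUnit (c - algebraMap k R a) := fun a ha ↦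
    hR.isUnit_of_deriv_eq_zero (by simp [hc, deriv_algebraMap, ha])
      (sub_ne_zero.mpr (hcon a).symm)
  have hint : IsIntegral k c := by
    refine (isAlgebraic_of_infinite_isUnit_sub c ?_).isIntegral
    refine (Set.infinite_range_of_injective (Nat.cast_injective (R := k))).mono ?_
    rintro _ ⟨m, rfl⟩
    exact hunit _ (Derivation.map_natCast _ m)
  have hmonic := minpoly.monic hint
  have hcoeff : Differential.mapCoeffs (minpoly k c) = 0 := by
    by_contra hne
    refine (minpoly.min k c (p := Polynomial.C _ * Differential.mapCoeffs (minpoly k c))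
      (Polynomial.monic_C_mul_of_mul_leadingCoeff_eq_one
        (inv_mul_cancel₀ (Polynomial.leadingCoeff_ne_zero.mpr hne))) ?_).not_gt ?_
    · have h := Differential.deriv_aeval_eq c (minpoly k c)
      rw [minpoly.aeval, map_zero, hc, mul_zero, add_zero] at h
      rw [map_mul, ← h, mul_zero]
    · rw [Polynomial.degree_C_mul (inv_ne_zero (Polynomial.leadingCoeff_ne_zero.mpr hne))]
      rw [Polynomial.degree_eq_natDegree hmonic.ne_zero, Polynomial.degree_lt_iff_coeff_zero]
      intro m hm
      rw [Differential.coeff_mapCoeffs]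
      rcases hm.eq_or_lt with rfl | hm
      · rw [hmonic.coeff_natDegree, Derivation.map_one_eq_zero]
      · rw [Polynomial.coeff_eq_zero_of_natDegree_lt hm, map_zero]
  obtain ⟨a, ha, hroot⟩ := hk (minpoly k c)
    (fun i ↦ by rw [← Differential.coeff_mapCoeffs, hcoeff, Polynomial.coeff_zero])
    (minpoly.degree_pos hint)
  obtain ⟨q, hq⟩ := Polynomial.dvd_iff_isRoot.mpr hroot
  have hqm : q.Monic := (Polynomial.monic_X_sub_C a).of_mul_monic_left (hq ▸ hmonic)
  have hqc : Polynomial.aeval c q = 0 := by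
    have h := minpoly.aeval k c
    rw [hq, map_mul, map_sub, Polynomial.aeval_X, Polynomial.aeval_C] at h
    exact (hunit a ha).mul_right_eq_zero.mp h
  refine (minpoly.min k c hqm hqc).not_gt ?_
  rw [hq, Polynomial.degree_mul, Polynomial.degree_X_sub_C,
    Polynomial.degree_eq_natDegree hqm.ne_zero]
  norm_cast
  omega

theorem Differential.deriv_smul {k R : Type*} [CommRing k] [Differential k] [CommRing R]
    [Differential R] [Algebra k R] [DifferentialAlgebra k R] (r : k) (a : R) :
    (r • a)′ = r′ • a + r • a′ := by
  rw [Algebra.smul_def, Derivation.leibniz, smul_eq_mul, smul_eq_mul, deriv_algebraMap,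
    Algebra.smul_def, Algebra.smul_def]
  ring

/-- The derivation `a ⊗ b ↦ a′ ⊗ b + a ⊗ b′` on a tensor product of differential algebras. -/
noncomputable def Differential.tensorProductAddHom (k R S : Type*) [CommRing k] [Differential k]
    [CommRing R] [Differential R] [Algebra k R] [DifferentialAlgebra k R]
    [CommRing S] [Differential S] [Algebra k S] [DifferentialAlgebra k S] :
    R ⊗[k] S →+ R ⊗[k] S :=
  TensorProduct.liftAddHom
    (AddMonoidHom.mk' (fun a ↦ AddMonoidHom.mk' (fun b ↦ a′ ⊗ₜ[k] b + a ⊗ₜ[k] b′) fun b b' ↦ by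
        simp only [map_add, TensorProduct.tmul_add]; abel)
      fun a a' ↦ by
        ext b
        simp only [map_add, TensorProduct.add_tmul, AddMonoidHom.mk'_apply,
          AddMonoidHom.add_apply]
        abel)
    fun r a b ↦ by
      simp only [AddMonoidHom.mk'_apply, Differential.deriv_smul, TensorProduct.add_tmul,
        TensorProduct.tmul_add, TensorProduct.tmul_smul, ← TensorProduct.smul_tmul']
      abel

theorem Differential.tensorProductAddHom_tmul {k R S : Type*} [CommRing k] [Differential k]
    [CommRing R] [Differential R] [Algebra k R] [DifferentialAlgebra k R]
    [CommRing S] [Differential S] [Algebra k S] [DifferentialAlgebra k S] (a : R) (b : S) :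
    Differential.tensorProductAddHom k R S (a ⊗ₜ b) = a′ ⊗ₜ b + a ⊗ₜ b′ :=
  rfl

/-- The differential ring structure on a tensor product of differential algebras. -/
@[reducible]
noncomputable def Differential.tensorProduct (k R S : Type*) [CommRing k] [Differential k]
    [CommRing R] [Differential R] [Algebra k R] [DifferentialAlgebra k R]
    [CommRing S] [Differential S] [Algebra k S] [DifferentialAlgebra k S] :
    Differential (R ⊗[k] S) where
  deriv := Derivation.mk' (Differential.tensorProductAddHom k R S).toIntLinearMap fun x y ↦ by
    simp only [AddMonoidHom.coe_toIntLinearMap, smul_eq_mul]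
    induction x with
    | zero => simp
    | add x x' hx hx' => simp only [add_mul, mul_add, map_add, hx, hx']; abel
    | tmul a b =>
      induction y with
      | zero => simp
      | add y y' hy hy' => simp only [add_mul, mul_add, map_add, hy, hy']; abel
      | tmul a' b' =>
        simp only [Algebra.TensorProduct.tmul_mul_tmul, Differential.tensorProductAddHom_tmul,
          Derivation.leibniz, smul_eq_mul, TensorProduct.add_tmul, TensorProduct.tmul_add, mul_add]
        rw [mul_comm a' a, mul_comm b' b, mul_comm a' a′, mul_comm b' b′]
        abel

/-- The differential ring structure on the quotient by a differential ideal. -/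
@[reducible]
noncomputable def Differential.quotient {R : Type*} [CommRing R] [Differential R] (I : Ideal R)
    (hI : ∀ a ∈ I, a′ ∈ I) : Differential (R ⧸ I) where
  deriv := Derivation.mk'
    (QuotientAddGroup.map I.toAddSubgroup I.toAddSubgroup
      (Differential.deriv (R := R)).toLinearMap.toAddMonoidHom hI).toIntLinearMap fun x y ↦ by
    obtain ⟨x, rfl⟩ := Ideal.Quotient.mk_surjective x
    obtain ⟨y, rfl⟩ := Ideal.Quotient.mk_surjective y
    exact congrArg (Ideal.Quotient.mk I) (Derivation.leibniz _ x y)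

/-- Every nonzero Noetherian differential ring has a differentially simple quotient. -/
theorem Differential.exists_ideal_quotient_isSimple (S : Type*) [CommRing S] [Nontrivial S]
    [Differential S] [IsNoetherianRing S] :
    ∃ (I : Ideal S) (hI : ∀ a ∈ I, a′ ∈ I), I ≠ ⊤ ∧
      letI := Differential.quotient I hI
      Differential.IsSimple (S ⧸ I) := by
  obtain ⟨I, ⟨hItop, hI⟩, hmax⟩ := set_has_maximal_iff_noetherian.mpr ‹IsNoetherianRing S›
    {I : Ideal S | I ≠ ⊤ ∧ ∀ a ∈ I, a′ ∈ I} ⟨⊥, bot_ne_top, by simp⟩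
  refine ⟨I, hI, hItop, ?_⟩
  let := Differential.quotient I hI
  intro J hJ
  have hle : I ≤ J.comap (Ideal.Quotient.mk I) := fun a ha ↦ by
    rw [Ideal.mem_comap, Ideal.Quotient.eq_zero_iff_mem.mpr ha]
    exact J.zero_mem
  by_cases htop : J.comap (Ideal.Quotient.mk I) = ⊤
  · right
    rwa [Ideal.comap_eq_top_iff] at htop
  · left
    have heq := hle.eq_of_not_lt (hmax _ ⟨htop, fun a ha ↦ hJ _ ha⟩)
    rw [eq_bot_iff]
    intro x hx
    obtain ⟨x, rfl⟩ := Ideal.Quotient.mk_surjective x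
    rw [Ideal.mem_bot, Ideal.Quotient.eq_zero_iff_mem, heq]
    exact hx

theorem Differential.map_deriv_mul {R n : Type*} [CommRing R] [Differential R] [Fintype n]
    (X Y : Matrix n n R) :
    (X * Y).map (fun a ↦ a′) = X.map (fun a ↦ a′) * Y + X * Y.map (fun a ↦ a′) := by
  ext i j
  simp [Matrix.mul_apply, Finset.sum_add_distrib, mul_comm, add_comm]

/-- Two fundamental matrices of the same equation differ by a matrix of constants. -/
theorem Differential.map_deriv_eq_zero_of_mul_eq {R n : Type*} [CommRing R] [Differential R]
    [Fintype n] [DecidableEq n] {A X Y M : Matrix n n R}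
    (hX : X.map (fun a ↦ a′) = A * X) (hY : Y.map (fun a ↦ a′) = A * Y) (hYM : Y * M = X)
    (hdet : IsUnit Y.det) : M.map (fun a ↦ a′) = 0 := by
  have h := Differential.map_deriv_mul Y M
  rw [hYM, hX, hY, Matrix.mul_assoc, hYM] at h
  have h0 : Y * M.map (fun a ↦ a′) = Y * 0 := by
    rw [mul_zero]
    exact left_eq_add.mp h
  exact ((Matrix.isUnit_iff_isUnit_det Y).mpr hdet).mul_left_cancel h0

/-- If all constants of `R` come from `k`, the subalgebra generated by a fundamental matrix and the
inverse of its determinant is contained in that generated by any other one. -/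
theorem Differential.adjoin_fundamentalMatrix_le {k R n : Type*} [Field k] [CommRing R]
    [Nontrivial R] [Algebra k R] [Differential R]
    (hconst : ∀ c : R, c′ = 0 → ∃ a : k, algebraMap k R a = c)
    [Fintype n] [DecidableEq n] {A X Y : Matrix n n R} {v w : R}
    (hX : X.map (fun a ↦ a′) = A * X) (hY : Y.map (fun a ↦ a′) = A * Y)
    (hv : X.det * v = 1) (hw : Y.det * w = 1) :
    Algebra.adjoin k ((Set.range fun p : n × n ↦ X p.1 p.2) ∪ {v}) ≤
      Algebra.adjoin k ((Set.range fun p : n × n ↦ Y p.1 p.2) ∪ {w}) := by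
  have hunit : IsUnit Y.det := .of_mul_eq_one _ hw
  have hYM : Y * (Y⁻¹ * X) = X := Matrix.mul_nonsing_inv_cancel_left _ _ hunit
  have hM := Differential.map_deriv_eq_zero_of_mul_eq hX hY hYM hunit
  choose N hN using fun i j ↦ hconst ((Y⁻¹ * X) i j) (congrFun (congrFun hM i) j)
  have hYN : Y * (Matrix.of N).map (algebraMap k R) = X := by
    rw [← hYM]
    congr 1
    ext i j
    exact hN i j
  have hdet : Y.det * algebraMap k R (Matrix.of N).det = X.det := by
    rw [← hYN, Matrix.det_mul, RingHom.map_det, RingHom.mapMatrix_apply]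
  have hN0 : (Matrix.of N).det ≠ 0 := fun h ↦ by
    rw [← hdet, h, map_zero, mul_zero, zero_mul] at hv
    exact zero_ne_one hv
  have hNinv : algebraMap k R (Matrix.of N).det * algebraMap k R (Matrix.of N).det⁻¹ = 1 := by
    rw [← map_mul, mul_inv_cancel₀ hN0, map_one]
  refine Algebra.adjoin_le (Set.union_subset ?_ ?_)
  · rintro _ ⟨⟨i, j⟩, rfl⟩
    simp only [← hYN, Matrix.mul_apply]
    exact Subalgebra.sum_mem _ fun l _ ↦ Subalgebra.mul_mem _
      (Algebra.subset_adjoin (.inl ⟨(i, l), rfl⟩)) (Subalgebra.algebraMap_mem _ _)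
  · rw [Set.singleton_subset_iff]
    have hvw : v = w * algebraMap k R (Matrix.of N).det⁻¹ := by
      refine (IsUnit.of_mul_eq_one _ hv).mul_left_cancel ?_
      rw [hv, ← hdet]
      linear_combination -hNinv - algebraMap k R (Matrix.of N).det *
        algebraMap k R (Matrix.of N).det⁻¹ * hw
    rw [hvw]
    exact Subalgebra.mul_mem _ (Algebra.subset_adjoin (.inr rfl)) (Subalgebra.algebraMap_mem _ _)

/-- A differential homomorphism carries a fundamental matrix to a fundamental matrix, and the
algebra it generates onto the range. -/
theorem Differential.map_fundamentalMatrix {k R S n : Type*} [Field k] [CommRing R] [Algebra k R]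
    [Differential R] [CommRing S] [Algebra k S] [Differential S] [Fintype n] [DecidableEq n]
    (f : R →ₐ[k] S) (hf : ∀ a, f a′ = (f a)′) {A : Matrix n n k} {Z : Matrix n n R} {w : R}
    (hw : Z.det * w = 1) (hZ : Z.map (fun a ↦ a′) = A.map (algebraMap k R) * Z)
    (hgen : Algebra.adjoin k ((Set.range fun p : n × n ↦ Z p.1 p.2) ∪ {w}) = ⊤) :
    (Z.map f).det * f w = 1 ∧ (Z.map f).map (fun a ↦ a′) = A.map (algebraMap k S) * Z.map f ∧
      Algebra.adjoin k ((Set.range fun p : n × n ↦ (Z.map f) p.1 p.2) ∪ {f w}) = f.range := by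
  refine ⟨?_, ?_, ?_⟩
  · rw [← AlgHom.mapMatrix_apply, ← AlgHom.map_det, ← map_mul, hw, map_one]
  · have h := congrArg (fun M ↦ M.map f) hZ
    simp only [Matrix.map_mul, Matrix.map_map] at h
    rw [Matrix.map_map, ← show f ∘ (fun a ↦ a′) = (fun a ↦ a′) ∘ f from funext hf, h]
    congr 2
    ext
    simp
  · rw [← Algebra.map_top, ← hgen, AlgHom.map_adjoin, Set.image_union, Set.image_singleton,
      ← Set.range_comp]
    rfl

/-- The differential ring structure given by an additive map satisfying the Leibniz rule. -/
@[reducible]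
def Differential.ofLeibniz {R : Type*} [CommRing R] (d : R → R)
    (hadd : ∀ a b, d (a + b) = d a + d b) (hmul : ∀ a b, d (a * b) = a * d b + d a * b) :
    Differential R where
  deriv := Derivation.mk' (AddMonoidHom.mk' d hadd).toIntLinearMap fun a b ↦ by
    simpa [mul_comm b] using hmul a b

/-- Uniqueness of Picard–Vessiot rings: over a differential field of characteristic zero
with algebraically closed constants, any two Picard–Vessiot rings for `d(Y) = A·Y`
are isomorphic as differential `k`-algebras. -/
theorem picardVessiotRing_unique
    {k : Type*} [Field k] [CharZero k] (dk : k → k)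
    (hdk_add : ∀ a b : k, dk (a + b) = dk a + dk b)
    (hdk_mul : ∀ a b : k, dk (a * b) = a * dk b + dk a * b)
    (hC_algClosed : ∀ p : Polynomial k, (∀ i, dk (p.coeff i) = 0) → 0 < p.degree →
      ∃ c : k, dk c = 0 ∧ p.IsRoot c)
    {n : Type*} [Fintype n] [DecidableEq n] (A : Matrix n n k)
    {R₁ : Type*} [CommRing R₁] [Algebra k R₁] (d₁ : R₁ → R₁)
    {R₂ : Type*} [CommRing R₂] [Algebra k R₂] (d₂ : R₂ → R₂)
    (h₁ : IsPicardVessiotRing dk A R₁ d₁)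
    (h₂ : IsPicardVessiotRing dk A R₂ d₂) :
    ∃ φ : R₁ ≃ₐ[k] R₂, ∀ a : R₁, φ (d₁ a) = d₂ (φ a) := by
  obtain ⟨hadd₁, hmul₁, hk₁, hne₁, hs₁, Z₁, w₁, hw₁, hZ₁, hgen₁⟩ := h₁
  obtain ⟨hadd₂, hmul₂, hk₂, hne₂, hs₂, Z₂, w₂, hw₂, hZ₂, hgen₂⟩ := h₂
  let := Differential.ofLeibniz dk hdk_add hdk_mul
  let := Differential.ofLeibniz d₁ hadd₁ hmul₁
  let := Differential.ofLeibniz d₂ hadd₂ hmul₂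
  have : DifferentialAlgebra k R₁ := ⟨hk₁⟩
  have : DifferentialAlgebra k R₂ := ⟨hk₂⟩
  have : Nontrivial R₁ := (Submodule.nontrivial_iff R₁).mp ⟨_, _, hne₁⟩
  have : Nontrivial R₂ := (Submodule.nontrivial_iff R₂).mp ⟨_, _, hne₂⟩
  have : Algebra.FiniteType k R₁ := ⟨Subalgebra.fg_def.mpr
    ⟨_, (Set.finite_range _).union (Set.finite_singleton _), hgen₁⟩⟩
  have : Algebra.FiniteType k R₂ := ⟨Subalgebra.fg_def.mpr
    ⟨_, (Set.finite_range _).union (Set.finite_singleton _), hgen₂⟩⟩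
  have : Algebra.FiniteType k (R₁ ⊗[k] R₂) :=
    Algebra.FiniteType.trans (S := R₁) inferInstance inferInstance
  have : IsNoetherianRing (R₁ ⊗[k] R₂) := Algebra.FiniteType.isNoetherianRing k _
  let := Differential.tensorProduct k R₁ R₂
  obtain ⟨I, hI, hItop, hsimple⟩ := Differential.exists_ideal_quotient_isSimple (R₁ ⊗[k] R₂)
  let := Differential.quotient I hI
  have : Nontrivial ((R₁ ⊗[k] R₂) ⧸ I) := Ideal.Quotient.nontrivial_iff.mpr hItop
  let ι₁ : R₁ →ₐ[k] (R₁ ⊗[k] R₂) ⧸ I :=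
    (Ideal.Quotient.mkₐ k I).comp Algebra.TensorProduct.includeLeft
  let ι₂ : R₂ →ₐ[k] (R₁ ⊗[k] R₂) ⧸ I :=
    (Ideal.Quotient.mkₐ k I).comp Algebra.TensorProduct.includeRight
  have hι₁ : ∀ a, ι₁ a′ = (ι₁ a)′ := fun a ↦ by
    refine congrArg (Ideal.Quotient.mk I) (?_ : _ = a′ ⊗ₜ[k] (1 : R₂) + a ⊗ₜ[k] (1 : R₂)′)
    rw [Derivation.map_one_eq_zero, TensorProduct.tmul_zero, add_zero]
    rfl
  have hι₂ : ∀ a, ι₂ a′ = (ι₂ a)′ := fun a ↦ by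
    refine congrArg (Ideal.Quotient.mk I) (?_ : _ = (1 : R₁)′ ⊗ₜ[k] a + (1 : R₁) ⊗ₜ[k] a′)
    rw [Derivation.map_one_eq_zero, TensorProduct.zero_tmul, zero_add]
    rfl
  have : DifferentialAlgebra k ((R₁ ⊗[k] R₂) ⧸ I) := ⟨fun a ↦ by
    rw [← ι₁.commutes, ← hι₁, deriv_algebraMap, ι₁.commutes]⟩
  have hconst : ∀ c : (R₁ ⊗[k] R₂) ⧸ I, c′ = 0 → ∃ a : k, algebraMap k _ a = c := fun c hc ↦
    hsimple.exists_algebraMap_eq hC_algClosed hc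
  obtain ⟨hv₁, hX₁, hr₁⟩ := Differential.map_fundamentalMatrix ι₁ hι₁ hw₁ hZ₁ hgen₁
  obtain ⟨hv₂, hX₂, hr₂⟩ := Differential.map_fundamentalMatrix ι₂ hι₂ hw₂ hZ₂ hgen₂
  have hrange : ι₁.range = ι₂.range := by
    rw [← hr₁, ← hr₂]
    exact le_antisymm (Differential.adjoin_fundamentalMatrix_le hconst hX₁ hX₂ hv₁ hv₂)
      (Differential.adjoin_fundamentalMatrix_le hconst hX₂ hX₁ hv₂ hv₁)
  have hinj₁ : Function.Injective ι₁ :=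
    Differential.IsSimple.injective (R := R₁) hs₁ ι₁.toRingHom hι₁
  have hinj₂ : Function.Injective ι₂ :=
    Differential.IsSimple.injective (R := R₂) hs₂ ι₂.toRingHom hι₂
  let φ : R₁ ≃ₐ[k] R₂ := (AlgEquiv.ofInjective ι₁ hinj₁).trans
    ((Subalgebra.equivOfEq _ _ hrange).trans (AlgEquiv.ofInjective ι₂ hinj₂).symm)
  have hφ : ∀ a, ι₂ (φ a) = ι₁ a := fun a ↦
    congrArg Subtype.val ((AlgEquiv.ofInjective ι₂ hinj₂).apply_symm_apply _)
  refine ⟨φ, fun a ↦ hinj₂ ?_⟩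
  rw [hφ]
  exact (hι₁ a).trans ((congrArg (fun x ↦ x′) (hφ a)).symm.trans (hι₂ (φ a)).symm)
end

section
/- Let k be a differential field of characteristic zero with derivation d whose field of constants C is algebraically closed, let A be an n×n matrix over k, let R be a Picard–Vessiot ring for d(Y) = A·Y over k, and let K = Frac(R) with the unique extension of the derivation. Then for every a ∈ K with a ∉ k there exists a k-algebra automorphism σ of K commuting with the derivation such that σ(a) ≠ a. -/
open TensorProduct Polynomial

/-- If `d` is not nilpotent, there is a differential ideal which is maximal among the
differential ideals containing no power of `d`. -/
theorem Derivation.exists_maximal_ideal_disjoint_powers {T : Type*} [CommRing T]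
    (D : Derivation ℤ T T) {d : T} (hd : ¬ IsNilpotent d) :
    ∃ P : Ideal T, (∀ x ∈ P, D x ∈ P) ∧ (∀ m : ℕ, d ^ m ∉ P) ∧
      ∀ Q : Ideal T, (∀ x ∈ Q, D x ∈ Q) → P < Q → ∃ m : ℕ, d ^ m ∈ Q := by
  let s : Set (Ideal T) := {I | (∀ x ∈ I, D x ∈ I) ∧ ∀ m : ℕ, d ^ m ∉ I}
  have hchain : ∀ c ⊆ s, IsChain (· ≤ ·) c → ∀ y ∈ c, ∃ ub ∈ s, ∀ z ∈ c, z ≤ ub := by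
    intro c hc hchain y hy
    have hmem {z : T} : z ∈ sSup c ↔ ∃ I ∈ c, z ∈ I :=
      Submodule.mem_sSup_of_directed ⟨y, hy⟩ hchain.directedOn
    refine ⟨sSup c, ⟨fun x hx ↦ ?_, fun m hm ↦ ?_⟩, fun z hz ↦ le_sSup hz⟩
    · obtain ⟨I, hI, hxI⟩ := hmem.1 hx
      exact hmem.2 ⟨I, hI, (hc hI).1 x hxI⟩
    · obtain ⟨I, hI, hxI⟩ := hmem.1 hm
      exact (hc hI).2 m hxI
  have hbot : ⊥ ∈ s := by
    refine ⟨fun x hx ↦ ?_, fun m hm ↦ hd ⟨m, by simpa using hm⟩⟩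
    rw [Ideal.mem_bot] at hx ⊢
    simp [hx]
  obtain ⟨P, -, hP⟩ := zorn_le_nonempty₀ s hchain ⊥ hbot
  refine ⟨P, hP.prop.1, hP.prop.2, fun Q hQ hPQ ↦ ?_⟩
  by_contra! h
  exact hPQ.not_ge (hP.le_of_ge ⟨hQ, h⟩ hPQ.le)

/-- A differential algebra over a field of characteristic zero in which every nonzero differential
ideal contains a power of a fixed non-nilpotent element is an integral domain. -/
theorem Derivation.isDomain_of_forall_pow_mem (k : Type*) [Field k] [CharZero k] {S : Type*}
    [CommRing S] [Algebra k S] (D : Derivation ℤ S S) {d : S} (hd : ¬ IsNilpotent d)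
    (hs : ∀ I : Ideal S, (∀ x ∈ I, D x ∈ I) → I ≠ ⊥ → ∃ m : ℕ, d ^ m ∈ I) : IsDomain S := by
  have hnat : ∀ (m : ℕ) (x : S), m ≠ 0 → (m : S) * x = 0 → x = 0 := by
    intro m x hm hx
    have h1 : algebraMap k S (m : k)⁻¹ * (m : S) = 1 := by
      rw [← _root_.map_natCast (algebraMap k S), ← map_mul,
        inv_mul_cancel₀ (Nat.cast_ne_zero.2 hm), map_one]
    rw [← one_mul x, ← h1, mul_assoc, hx, mul_zero]
  have hann : ∀ a : S, ¬ IsNilpotent a → ∀ m b, a ^ m * b = 0 → b = 0 := by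
    -- the ideal of elements killed by a power of `a` is a differential ideal
    have key : ∀ a : S, ∃ I : Ideal S, (∀ x ∈ I, D x ∈ I) ∧
        ∀ x, x ∈ I ↔ ∃ m : ℕ, a ^ m * x = 0 := by
      intro a
      refine ⟨{ carrier := {x | ∃ m : ℕ, a ^ m * x = 0}
                add_mem' := ?_, zero_mem' := ⟨0, by simp⟩, smul_mem' := ?_ }, ?_, fun _ ↦ Iff.rfl⟩
      · rintro x y ⟨m, hm⟩ ⟨l, hl⟩
        refine ⟨m + l, ?_⟩
        linear_combination a ^ l * hm + a ^ m * hl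
      · rintro r x ⟨m, hm⟩
        refine ⟨m, ?_⟩
        rw [smul_eq_mul]
        linear_combination r * hm
      · rintro x ⟨m, hm⟩
        refine ⟨m + 1, ?_⟩
        have h := congrArg D hm
        rw [D.leibniz, D.leibniz_pow, map_zero] at h
        simp only [smul_eq_mul, nsmul_eq_mul] at h
        rcases m with _ | m
        · simp only [pow_zero, one_mul] at hm
          simp [hm]
        · simp only [add_tsub_cancel_right] at h
          linear_combination a * h - ((m + 1 : ℕ) : S) * D a * hm
    intro a ha m b hb
    by_contra hb0
    obtain ⟨I, hI, hmem⟩ := key a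
    obtain ⟨l, hl⟩ := hs I hI (fun h ↦ hb0 (by simpa [h] using (hmem b).2 ⟨m, hb⟩))
    obtain ⟨i, hi⟩ := (hmem _).1 hl
    obtain ⟨J, hJ, hmemJ⟩ := key d
    have haJ : a ^ i ∈ J := (hmemJ _).2 ⟨l, by rw [mul_comm]; exact hi⟩
    obtain ⟨j, hj⟩ := hs J hJ (fun h ↦ ha ⟨i, by simpa [h] using haJ⟩)
    obtain ⟨q, hq⟩ := (hmemJ _).1 hj
    exact hd ⟨q + j, by rw [pow_add, hq]⟩
  have hred : ∀ x : S, IsNilpotent x → x = 0 := by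
    intro x hx
    have hN : ∀ y ∈ nilradical S, D y ∈ nilradical S := by
      intro y hy
      rw [mem_nilradical] at hy ⊢
      by_contra hDy
      obtain ⟨m, hm, hmin⟩ : ∃ m : ℕ, y ^ m = 0 ∧ ∀ l < m, y ^ l ≠ 0 := by
        classical
        exact ⟨Nat.find hy, Nat.find_spec hy, fun l hl ↦ Nat.find_min hy hl⟩
      rcases m with _ | m
      · have h1 : (1 : S) = 0 := by simpa using hm
        exact hDy ⟨1, by rw [pow_one, ← mul_one (D y), h1, mul_zero]⟩
      · have h := congrArg D hm
        rw [D.leibniz_pow, map_zero, add_tsub_cancel_right, nsmul_eq_mul, smul_eq_mul] at h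
        have h := hnat _ _ m.succ_ne_zero h
        exact hmin m m.lt_succ_self (hann _ hDy 1 _ (by rw [pow_one, mul_comm]; exact h))
    by_contra hx0
    obtain ⟨m, hm⟩ := hs _ hN (fun h ↦ hx0 (by
      have : x ∈ nilradical S := hx
      simpa [h] using this))
    exact hd ((mem_nilradical.1 hm).of_pow)
  have : Nontrivial S := by
    by_contra h
    rw [not_nontrivial_iff_subsingleton] at h
    exact hd ⟨1, Subsingleton.elim _ _⟩
  have : NoZeroDivisors S := by
    refine ⟨fun {a b} hab ↦ ?_⟩
    by_cases ha : IsNilpotent a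
    · exact Or.inl (hred a ha)
    · exact Or.inr (hann a ha 1 b (by rwa [pow_one]))
  exact NoZeroDivisors.to_isDomain S

/-- A transcendental element `c` of a finitely generated domain over a field `k` of characteristic
zero cannot have all its translates by natural numbers invertible. -/
theorem Transcendental.exists_nat_not_isUnit_sub {k S : Type*} [Field k] [CharZero k] [CommRing S]
    [IsDomain S] [Algebra k S] [Algebra.FiniteType k S] {c : S} (hc : Transcendental k c) :
    ∃ m : ℕ, ¬ IsUnit (c - (m : S)) := by
  let : Algebra k[X] S := (Polynomial.aeval c).toAlgebra
  have halg : ∀ p : k[X], algebraMap k[X] S p = Polynomial.aeval c p := fun _ ↦ rfl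
  have hinj : Function.Injective (algebraMap k[X] S) := transcendental_iff_injective.1 hc
  have : IsScalarTower k k[X] S := IsScalarTower.of_algebraMap_eq fun x ↦ by
    rw [halg, Polynomial.algebraMap_eq, aeval_C]
  have : Algebra.FiniteType k[X] S := .of_restrictScalars_finiteType k k[X] S
  have : Algebra.FinitePresentation k[X] S := Algebra.FinitePresentation.of_finiteType.1 ‹_›
  have : FaithfulSMul k[X] S := (faithfulSMul_iff_algebraMap_injective _ _).2 hinj
  have : Module.IsTorsionFree k[X] S := Module.isTorsionFree_iff_faithfulSMul.2 inferInstance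
  have hopen := PrimeSpectrum.isOpenMap_comap_of_hasGoingDown_of_finitePresentation
    (R := k[X]) (S := S)
  have hbot : (⊥ : PrimeSpectrum k[X]) ∈
      Set.range (PrimeSpectrum.comap (algebraMap k[X] S)) := by
    refine ⟨⊥, ?_⟩
    ext x
    simp
  obtain ⟨_, ⟨f, rfl⟩, hf0, hf⟩ :=
    PrimeSpectrum.isTopologicalBasis_basic_opens.exists_subset_of_mem_open hbot hopen.isOpen_range
  have hf0 : f ≠ 0 := by simpa using hf0
  obtain ⟨m, hm⟩ : ∃ m : ℕ, f.eval (m : k) ≠ 0 := by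
    by_contra! h
    refine hf0 (Polynomial.eq_zero_of_infinite_isRoot f ?_)
    exact (Set.infinite_range_of_injective (Nat.cast_injective (R := k))).mono
      (by rintro _ ⟨m, rfl⟩; exact h m)
  refine ⟨m, fun hu ↦ ?_⟩
  have hprime : (Ideal.span {(X - C (m : k) : k[X])}).IsPrime :=
    (Ideal.span_singleton_prime (X_sub_C_ne_zero _)).2 (prime_X_sub_C _)
  obtain ⟨q, hq⟩ := hf (show (⟨_, hprime⟩ : PrimeSpectrum k[X]) ∈ _ by
    change f ∉ Ideal.span {(X - C (m : k) : k[X])}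
    rw [Ideal.mem_span_singleton, dvd_iff_isRoot]
    exact hm)
  have hmem : (X - C (m : k) : k[X]) ∈ (PrimeSpectrum.comap (algebraMap k[X] S) q).asIdeal := by
    rw [hq]
    exact Ideal.mem_span_singleton_self _
  have hmem : c - (m : S) ∈ q.asIdeal := by
    have : algebraMap k[X] S (X - C (m : k)) ∈ q.asIdeal := hmem
    simpa [halg] using this
  exact q.2.ne_top (Ideal.eq_top_of_isUnit_mem _ hmem hu)

/-- Let `S` be a finitely generated differential domain over `k`, whose nonzero differential
ideals all contain a power of a fixed `d ≠ 0`. If the constants of `k` are algebraically closed,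
then `S` has no new constants. -/
theorem Derivation.mem_range_algebraMap_of_forall_pow_mem {k S : Type*} [Field k] [CharZero k]
    [CommRing S] [IsDomain S] [Algebra k S] [Algebra.FiniteType k S]
    (δ : Derivation ℤ k k)
    (hC : ∀ p : k[X], (∀ i, δ (p.coeff i) = 0) → 0 < p.degree → ∃ c : k, δ c = 0 ∧ p.IsRoot c)
    (D : Derivation ℤ S S) (hD : ∀ x : k, D (algebraMap k S x) = algebraMap k S (δ x))
    {d : S} (hd : d ≠ 0)
    (hs : ∀ I : Ideal S, (∀ x ∈ I, D x ∈ I) → I ≠ ⊥ → ∃ m : ℕ, d ^ m ∈ I)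
    {c : S} (hc : D c = 0) : c ∈ (algebraMap k S).range := by
  have halg : IsAlgebraic k c := by
    by_contra htr
    have hle : Submonoid.powers d ≤ nonZeroDivisors S :=
      powers_le_nonZeroDivisors_of_noZeroDivisors hd
    have : IsDomain (Localization.Away d) := IsLocalization.isDomain_localization hle
    have : Algebra.FiniteType S (Localization.Away d) :=
      IsLocalization.finiteType_of_monoid_fg (Submonoid.powers d) _
    have : Algebra.FiniteType k (Localization.Away d) := .trans ‹_› ‹Algebra.FiniteType S _›
    have hinj : Function.Injective (algebraMap S (Localization.Away d)) :=
      IsLocalization.injective _ hle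
    have htr' : Transcendental k (algebraMap S (Localization.Away d) c) :=
      fun h ↦ htr ((isAlgebraic_algebraMap_iff hinj).1 h)
    obtain ⟨m, hm⟩ := htr'.exists_nat_not_isUnit_sub
    have hne : c - (m : S) ≠ 0 := by
      intro h
      refine htr ?_
      rw [sub_eq_zero.1 h]
      exact isAlgebraic_natCast m
    have hDm : D (c - (m : S)) = 0 := by rw [map_sub, hc, D.map_natCast, sub_zero]
    obtain ⟨l, hl⟩ := hs (Ideal.span {c - (m : S)}) (by
      intro x hx
      obtain ⟨y, rfl⟩ := Ideal.mem_span_singleton'.1 hx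
      rw [D.leibniz, hDm, smul_zero, zero_add, smul_eq_mul]
      exact Ideal.mul_mem_right _ _ (Ideal.mem_span_singleton_self _))
      (by simpa [Ideal.span_singleton_eq_bot] using hne)
    refine hm (isUnit_of_dvd_unit (y := algebraMap S (Localization.Away d) (d ^ l)) ?_ ?_)
    · simpa using map_dvd (algebraMap S (Localization.Away d)) (Ideal.mem_span_singleton.1 hl)
    · exact IsLocalization.map_units _ (⟨d ^ l, l, rfl⟩ : Submonoid.powers d)
  let : Differential k := ⟨δ⟩
  let : Differential S := ⟨D⟩
  have : DifferentialAlgebra k S := ⟨hD⟩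
  have hint : IsIntegral k c := halg.isIntegral
  have hzero : Differential.mapCoeffs (minpoly k c) = 0 := by
    by_contra hne
    have h0 := Differential.deriv_aeval_eq (A := k) c (minpoly k c)
    have hc' : Differential.deriv c = 0 := hc
    rw [minpoly.aeval, map_zero, hc', mul_zero, add_zero] at h0
    have hdeg := minpoly.degree_le_of_ne_zero k c hne h0.symm
    have hnd := natDegree_le_natDegree hdeg
    have hle : (Differential.mapCoeffs (minpoly k c)).natDegree ≤ (minpoly k c).natDegree := by
      rw [natDegree_le_iff_coeff_eq_zero]
      intro i hi
      rw [Differential.coeff_mapCoeffs, coeff_eq_zero_of_natDegree_lt hi, map_zero]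
    have hlead : (Differential.mapCoeffs (minpoly k c)).leadingCoeff = 0 := by
      rw [leadingCoeff, le_antisymm hle hnd, Differential.coeff_mapCoeffs]
      have h1 : (minpoly k c).coeff (minpoly k c).natDegree = 1 := minpoly.monic hint
      rw [h1, Derivation.map_one_eq_zero]
    exact hne (leadingCoeff_eq_zero.1 hlead)
  obtain ⟨r, -, hr⟩ := hC (minpoly k c)
    (fun i ↦ congrArg (fun p : k[X] ↦ p.coeff i) hzero) (minpoly.degree_pos hint)
  exact minpoly.mem_range_of_degree_eq_one k c
    (degree_eq_one_of_irreducible_of_root (minpoly.irreducible hint) hr)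

/-- Over a field, if `g₁ e ≠ g₂ e` for two homomorphisms into a domain, then `e ⊗ 1 - 1 ⊗ e` is not
nilpotent, and remains so in any algebra containing the source. -/
theorem Algebra.TensorProduct.not_isNilpotent_tmul_sub_tmul {k E K Ω : Type*} [Field k]
    [CommRing E] [CommRing K] [CommRing Ω] [IsDomain Ω] [Algebra k E] [Algebra k K] [Algebra k Ω]
    (f : E →ₐ[k] K) (hf : Function.Injective f) (g₁ g₂ : E →ₐ[k] Ω) {e : E} (he : g₁ e ≠ g₂ e) :
    ¬ IsNilpotent (f e ⊗ₜ[k] (1 : K) - (1 : K) ⊗ₜ[k] f e) := by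
  intro h
  have hinj : Function.Injective (Algebra.TensorProduct.map f f) :=
    TensorProduct.map_injective_of_flat_flat f.toLinearMap f.toLinearMap hf hf
  have h1 : Algebra.TensorProduct.map f f (e ⊗ₜ[k] 1 - 1 ⊗ₜ[k] e) =
      f e ⊗ₜ[k] (1 : K) - (1 : K) ⊗ₜ[k] f e := by simp
  rw [← h1, IsNilpotent.map_iff hinj] at h
  have h2 := (h.map (Algebra.TensorProduct.productMap g₁ g₂)).eq_zero
  simp only [map_sub, Algebra.TensorProduct.productMap_apply_tmul, map_one, mul_one, one_mul] at h2
  exact he (sub_eq_zero.1 h2)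

theorem Algebra.TensorProduct.not_isNilpotent_tmul_sub_tmul_of_notMem_range {k K : Type*} [Field k]
    [CharZero k] [Field K] [Algebra k K] {a : K} (ha : a ∉ (algebraMap k K).range) :
    ¬ IsNilpotent (a ⊗ₜ[k] (1 : K) - (1 : K) ⊗ₜ[k] a) := by
  by_cases halg : IsAlgebraic k a
  · have hint : IsIntegral k a := halg.isIntegral
    let E := IntermediateField.adjoin k {a}
    let e : E := IntermediateField.AdjoinSimple.gen k a
    have : Algebra.IsAlgebraic k E := IntermediateField.isAlgebraic_adjoin_simple hint
    let g : E →ₐ[k] AlgebraicClosure k := IsAlgClosed.lift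
    have hg : g e ∉ (⊥ : IntermediateField k (AlgebraicClosure k)) := by
      rintro ⟨r, hr⟩
      refine ha ⟨r, ?_⟩
      have h1 : algebraMap k E r = e := g.injective ((g.commutes r).trans hr)
      exact congrArg (algebraMap E K) h1
    rw [InfiniteGalois.mem_bot_iff_fixed] at hg
    push Not at hg
    obtain ⟨τ, hτ⟩ := hg
    exact Algebra.TensorProduct.not_isNilpotent_tmul_sub_tmul E.val E.val.injective
      (τ.toAlgHom.comp g) g (e := e) hτ
  · have := Algebra.TensorProduct.not_isNilpotent_tmul_sub_tmul (aeval a)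
      (transcendental_iff_injective.1 halg) (aeval (0 : k)) (aeval (1 : k)) (e := X) (by simp)
    simpa using this

/-- For `a = b / c` in the fraction field of `R` and not in `k`, the element `b ⊗ c - c ⊗ b` is not
nilpotent. -/
theorem Algebra.TensorProduct.not_isNilpotent_tmul_sub_tmul_of_mul_eq {k R K : Type*} [Field k]
    [CharZero k] [CommRing R] [Field K] [Algebra k R] [Algebra k K] (f : R →ₐ[k] K) {a : K}
    (ha : a ∉ (algebraMap k K).range) {b c : R} (hc : f c ≠ 0) (habc : a * f c = f b) :
    ¬ IsNilpotent (b ⊗ₜ[k] c - c ⊗ₜ[k] b) := by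
  intro h
  have h1 := h.map (Algebra.TensorProduct.map f f)
  have h2 : Algebra.TensorProduct.map f f (b ⊗ₜ[k] c - c ⊗ₜ[k] b) =
      (f c ⊗ₜ[k] f c) * (a ⊗ₜ[k] (1 : K) - (1 : K) ⊗ₜ[k] a) := by
    rw [mul_sub, Algebra.TensorProduct.tmul_mul_tmul, Algebra.TensorProduct.tmul_mul_tmul, map_sub,
      Algebra.TensorProduct.map_tmul, Algebra.TensorProduct.map_tmul, ← habc, mul_one, mul_comm a]
  have hinv : ((f c)⁻¹ ⊗ₜ[k] (f c)⁻¹) * (f c ⊗ₜ[k] f c) = (1 : K ⊗[k] K) := by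
    rw [Algebra.TensorProduct.tmul_mul_tmul, inv_mul_cancel₀ hc, Algebra.TensorProduct.one_def]
  rw [h2] at h1
  have h3 := (Commute.all ((f c)⁻¹ ⊗ₜ[k] (f c)⁻¹) _).isNilpotent_mul_left h1
  rw [← mul_assoc, hinv, one_mul] at h3
  exact Algebra.TensorProduct.not_isNilpotent_tmul_sub_tmul_of_notMem_range ha h3

/-- The derivation `x ⊗ y ↦ D x ⊗ y + x ⊗ D y` on the tensor square of a differential algebra. -/
theorem Derivation.exists_tensorProduct {k R : Type*} [Field k] [CommRing R] [Algebra k R]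
    (δ : k → k) (D : Derivation ℤ R R) (hD : ∀ x : k, D (algebraMap k R x) = algebraMap k R (δ x)) :
    ∃ D₂ : Derivation ℤ (R ⊗[k] R) (R ⊗[k] R),
      ∀ x y : R, D₂ (x ⊗ₜ y) = D x ⊗ₜ y + x ⊗ₜ D y := by
  have hadd₂ (x y z : R) : D x ⊗ₜ[k] (y + z) + x ⊗ₜ[k] D (y + z) =
      D x ⊗ₜ y + x ⊗ₜ D y + (D x ⊗ₜ z + x ⊗ₜ D z) := by
    simp only [map_add, tmul_add]
    abel
  have hadd₁ (x z y : R) : D (x + z) ⊗ₜ[k] y + (x + z) ⊗ₜ[k] D y =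
      D x ⊗ₜ y + x ⊗ₜ D y + (D z ⊗ₜ y + z ⊗ₜ D y) := by
    simp only [map_add, add_tmul]
    abel
  let B : R →+ R →+ R ⊗[k] R := AddMonoidHom.mk'
    (fun x ↦ AddMonoidHom.mk' (fun y ↦ D x ⊗ₜ y + x ⊗ₜ D y) (hadd₂ x))
    (fun x z ↦ AddMonoidHom.ext (hadd₁ x z))
  have hB : ∀ x y, B x y = D x ⊗ₜ y + x ⊗ₜ D y := fun _ _ ↦ rfl
  have hsmul : ∀ (r : k) (x : R), D (r • x) = r • D x + δ r • x := by
    intro r x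
    rw [Algebra.smul_def, D.leibniz, hD, smul_eq_mul, smul_eq_mul, Algebra.smul_def,
      Algebra.smul_def, mul_comm x]
  let F : R ⊗[k] R →+ R ⊗[k] R := TensorProduct.liftAddHom B (fun r x y ↦ by
    rw [hB, hB, hsmul, hsmul]
    simp only [add_tmul, tmul_add, smul_tmul]
    abel)
  have hF : ∀ x y, F (x ⊗ₜ y) = D x ⊗ₜ y + x ⊗ₜ D y := fun _ _ ↦ rfl
  refine ⟨Derivation.mk' F.toIntLinearMap ?_, hF⟩
  intro s t
  change F (s * t) = s * F t + t * F s
  induction s with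
  | zero => simp
  | add s₁ s₂ h₁ h₂ => rw [add_mul, map_add, h₁, h₂, map_add]; ring
  | tmul x y =>
    induction t with
    | zero => simp
    | add t₁ t₂ h₁ h₂ => rw [mul_add, map_add, h₁, h₂, map_add]; ring
    | tmul u v =>
      rw [Algebra.TensorProduct.tmul_mul_tmul, hF, hF, hF, D.leibniz, D.leibniz]
      simp only [mul_add, Algebra.TensorProduct.tmul_mul_tmul, smul_eq_mul, add_tmul, tmul_add,
        mul_comm]
      abel

/-- If `S` has no new constants, any two differential homomorphisms from a Picard–Vessiot ring
to `S` have the same range; here is one inclusion. -/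
theorem Derivation.range_le_range_of_fundamentalMatrix {k R S n : Type*} [Field k] [CommRing R]
    [CommRing S] [IsDomain S] [Algebra k R] [Algebra k S] [Fintype n] [DecidableEq n]
    (A : Matrix n n k) (D : Derivation ℤ R R) (D' : Derivation ℤ S S)
    (hconst : ∀ c : S, D' c = 0 → c ∈ (algebraMap k S).range)
    {Z : Matrix n n R} {w : R} (hw : Z.det * w = 1)
    (hZ : Z.map D = A.map (algebraMap k R) * Z)
    (hgen : Algebra.adjoin k ((Set.range fun p : n × n => Z p.1 p.2) ∪ {w}) = ⊤)
    (φ₁ φ₂ : R →ₐ[k] S) (h₁ : ∀ x, D' (φ₁ x) = φ₁ (D x)) (h₂ : ∀ x, D' (φ₂ x) = φ₂ (D x)) :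
    φ₂.range ≤ φ₁.range := by
  have hmapZ : ∀ φ : R →ₐ[k] S, (∀ x, D' (φ x) = φ (D x)) →
      (Z.map φ).map D' = A.map (algebraMap k S) * Z.map φ := by
    intro φ hφ
    have h := congrArg (fun M : Matrix n n R ↦ M.map φ) hZ
    ext i j
    have := congrFun (congrFun h i) j
    simpa [hφ, Matrix.mul_apply] using this
  have hdet : ∀ φ : R →ₐ[k] S, (Z.map φ).det * φ w = 1 := by
    intro φ
    have := congrArg φ hw
    rw [map_mul, map_one, AlgHom.map_det] at this
    exact this
  set Z₁ := Z.map φ₁ with hZ₁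
  set Z₂ := Z.map φ₂ with hZ₂
  let W : Matrix n n S := φ₁ w • Z₁.adjugate
  have hZW : Z₁ * W = 1 := by
    rw [Matrix.mul_smul, Matrix.mul_adjugate, smul_smul, mul_comm, hdet, one_smul]
  have hWZ : W * Z₁ = 1 := mul_eq_one_comm.1 hZW
  have hDmul : ∀ M N : Matrix n n S, (M * N).map D' = M * N.map D' + M.map D' * N := by
    intro M N
    ext i j
    simp only [Matrix.map_apply, Matrix.mul_apply, Matrix.add_apply, map_sum, D'.leibniz,
      smul_eq_mul, Finset.sum_add_distrib]
    congr 1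
    exact Finset.sum_congr rfl fun _ _ ↦ mul_comm _ _
  have hM : Z₁ * (W * Z₂) = Z₂ := by rw [← mul_assoc, hZW, one_mul]
  have hDM : (W * Z₂).map D' = 0 := by
    have h := hDmul Z₁ (W * Z₂)
    rw [hM, hmapZ φ₁ h₁, hmapZ φ₂ h₂, mul_assoc, hM] at h
    have h : Z₁ * (W * Z₂).map D' = 0 := left_eq_add.1 (h.trans (add_comm _ _))
    rw [← one_mul ((W * Z₂).map D'), ← hWZ, mul_assoc, h, mul_zero]
  have hex : ∀ i j, ∃ r : k, algebraMap k S r = (W * Z₂) i j := fun i j ↦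
    hconst _ (congrFun (congrFun hDM i) j)
  choose M hMs using hex
  have hM0 : (Matrix.of M).map (algebraMap k S) = W * Z₂ := by
    ext i j
    exact hMs i j
  have hmem : ∀ i j, Z₂ i j ∈ φ₁.range := by
    intro i j
    rw [← hM, Matrix.mul_apply]
    refine Subalgebra.sum_mem _ fun l _ ↦ Subalgebra.mul_mem _ ⟨Z i l, rfl⟩ ?_
    rw [← hMs]
    exact Subalgebra.algebraMap_mem _ _
  have hdetM : φ₂ w = φ₁ w * algebraMap k S (Matrix.of M).det⁻¹ := by
    have h := congrArg Matrix.det hM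
    have h0 : (W * Z₂).det = algebraMap k S (Matrix.of M).det := by
      rw [← hM0, RingHom.map_det]
      rfl
    rw [Matrix.det_mul, h0] at h
    have e₁ := hdet φ₁
    have e₂ := hdet φ₂
    have hne : (Matrix.of M).det ≠ 0 := by
      intro h00
      rw [h00, map_zero, mul_zero] at h
      rw [← hZ₂, ← h, zero_mul] at e₂
      exact zero_ne_one e₂
    have hinv : algebraMap k S (Matrix.of M).det * algebraMap k S (Matrix.of M).det⁻¹ = 1 := by
      rw [← map_mul, mul_inv_cancel₀ hne, map_one]
    rw [← hZ₁] at e₁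
    rw [← hZ₂, ← h] at e₂
    linear_combination (-φ₂ w) * e₁ + φ₁ w * algebraMap k S (Matrix.of M).det⁻¹ * e₂ -
      φ₂ w * φ₁ w * Z₁.det * hinv
  rw [← Algebra.map_top, ← hgen, AlgHom.map_adjoin, Algebra.adjoin_le_iff]
  rintro _ ⟨x, ⟨⟨i, j⟩, rfl⟩ | rfl, rfl⟩
  · exact hmem i j
  · change φ₂ _ ∈ φ₁.range
    rw [hdetM]
    exact Subalgebra.mul_mem _ ⟨_, rfl⟩ (Subalgebra.algebraMap_mem _ _)

/-- If `d` is not nilpotent, some differential quotient keeps `d` non-nilpotent while every nonzero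
differential ideal of the quotient contains a power of `d`. -/
theorem Derivation.exists_quotient_forall_pow_mem.{u, v} (k : Type u) {T : Type v} [Field k] [CommRing T]
    [Algebra k T] (D : Derivation ℤ T T) {d : T} (hd : ¬ IsNilpotent d) :
    ∃ (S : Type v) (_ : CommRing S) (_ : Algebra k S) (π : T →ₐ[k] S) (D' : Derivation ℤ S S),
      Function.Surjective π ∧ (∀ x, D' (π x) = π (D x)) ∧ ¬ IsNilpotent (π d) ∧
      ∀ I : Ideal S, (∀ x ∈ I, D' x ∈ I) → I ≠ ⊥ → ∃ m : ℕ, π d ^ m ∈ I := by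
  obtain ⟨P, hPD, hPd, hPmax⟩ := D.exists_maximal_ideal_disjoint_powers hd
  let π : T →ₐ[k] T ⧸ P := Ideal.Quotient.mkₐ k P
  have hπ : Function.Surjective π := Ideal.Quotient.mkₐ_surjective k P
  have hπ0 : ∀ x, π x = 0 ↔ x ∈ P := fun x ↦ Ideal.Quotient.eq_zero_iff_mem
  have hDπ : ∀ x, π.toRingHom.toIntAlgHom x = 0 → π.toRingHom.toIntAlgHom (D x) = 0 :=
    fun x hx ↦ (hπ0 _).2 (hPD x ((hπ0 x).1 hx))
  have hD' := Derivation.liftOfSurjective_apply (f := π.toRingHom.toIntAlgHom) hπ hDπ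
  refine ⟨T ⧸ P, inferInstance, inferInstance, π,
    Derivation.liftOfSurjective (f := π.toRingHom.toIntAlgHom) hπ hDπ, hπ, hD', ?_, ?_⟩
  · rintro ⟨m, hm⟩
    rw [← map_pow, hπ0] at hm
    exact hPd m hm
  · intro I hI hI0
    obtain ⟨m, hm⟩ := hPmax (I.comap π) (fun x hx ↦ by
      rw [Ideal.mem_comap] at hx ⊢
      have h := hI _ hx
      exact (hD' x) ▸ h) (by
      refine lt_of_le_of_ne (fun x hx ↦ ?_) (fun h ↦ hI0 ?_)
      · rw [Ideal.mem_comap, (hπ0 x).2 hx]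
        exact I.zero_mem
      · rw [eq_bot_iff]
        intro y hy
        obtain ⟨x, rfl⟩ := hπ y
        exact (hπ0 x).2 (by rw [h]; exact hy))
    exact ⟨m, by simpa using hm⟩

/-- Let `i₁`, `i₂` be differential homomorphisms from a Picard–Vessiot ring to a finitely generated
differential algebra. If `i₁ b * i₂ c - i₁ c * i₂ b` is not nilpotent, then some differential
automorphism moves the ratio of `b` and `c`. -/
theorem Derivation.exists_algEquiv_mul_ne_mul {k R T n : Type*} [Field k] [CharZero k] [CommRing R]
    [Algebra k R] [CommRing T] [Algebra k T] [Algebra.FiniteType k T] [Fintype n] [DecidableEq n]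
    (δ : Derivation ℤ k k)
    (hC : ∀ p : k[X], (∀ i, δ (p.coeff i) = 0) → 0 < p.degree → ∃ c : k, δ c = 0 ∧ p.IsRoot c)
    (A : Matrix n n k) (D : Derivation ℤ R R)
    (hD : ∀ x : k, D (algebraMap k R x) = algebraMap k R (δ x))
    (hsimple : ∀ I : Ideal R, (∀ a ∈ I, D a ∈ I) → I = ⊥ ∨ I = ⊤)
    {Z : Matrix n n R} {w : R} (hw : Z.det * w = 1)
    (hZ : Z.map D = A.map (algebraMap k R) * Z)
    (hgen : Algebra.adjoin k ((Set.range fun p : n × n => Z p.1 p.2) ∪ {w}) = ⊤)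
    (DT : Derivation ℤ T T) (i₁ i₂ : R →ₐ[k] T) (hi₁ : ∀ x, DT (i₁ x) = i₁ (D x))
    (hi₂ : ∀ x, DT (i₂ x) = i₂ (D x))
    {b c : R} (hbc : ¬ IsNilpotent (i₁ b * i₂ c - i₁ c * i₂ b)) :
    ∃ σ : R ≃ₐ[k] R, (∀ x, σ (D x) = D (σ x)) ∧ σ b * c ≠ σ c * b := by
  obtain ⟨S, _, _, π, D', hπ, hD', hdnil, hpow⟩ := DT.exists_quotient_forall_pow_mem k hbc
  set d : T := i₁ b * i₂ c - i₁ c * i₂ b with hd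
  have : IsDomain S := D'.isDomain_of_forall_pow_mem k hdnil hpow
  have : Algebra.FiniteType k S := .of_surjective π hπ
  let φ₁ : R →ₐ[k] S := π.comp i₁
  let φ₂ : R →ₐ[k] S := π.comp i₂
  have hφ₁ : ∀ x, D' (φ₁ x) = φ₁ (D x) := fun x ↦ (hD' _).trans (congrArg π (hi₁ x))
  have hφ₂ : ∀ x, D' (φ₂ x) = φ₂ (D x) := fun x ↦ (hD' _).trans (congrArg π (hi₂ x))
  have hconst : ∀ x, D' x = 0 → x ∈ (algebraMap k S).range := fun x hx ↦
    Derivation.mem_range_algebraMap_of_forall_pow_mem δ hC D'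
      (fun r ↦ by rw [← φ₁.commutes, hφ₁, hD, φ₁.commutes])
      (fun h ↦ hdnil (by rw [h]; exact IsNilpotent.zero)) hpow hx
  have hinj : ∀ φ : R →ₐ[k] S, (∀ x, D' (φ x) = φ (D x)) →
      Function.Injective φ := by
    intro φ hφ
    rw [injective_iff_map_eq_zero]
    intro x hx
    rcases hsimple (RingHom.ker φ) (fun y hy ↦ by
      rw [RingHom.mem_ker] at hy ⊢
      rw [← hφ, hy, map_zero]) with h | h
    · exact (Ideal.mem_bot.1 (h ▸ (RingHom.mem_ker.2 hx)))
    · exact absurd h (RingHom.ker_ne_top φ)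
  have hrange : φ₁.range = φ₂.range := le_antisymm
    (Derivation.range_le_range_of_fundamentalMatrix A D D' hconst hw hZ hgen φ₂ φ₁ hφ₂ hφ₁)
    (Derivation.range_le_range_of_fundamentalMatrix A D D' hconst hw hZ hgen φ₁ φ₂ hφ₁ hφ₂)
  let σ : R ≃ₐ[k] R := (AlgEquiv.ofInjective φ₁ (hinj φ₁ hφ₁)).trans
    ((Subalgebra.equivOfEq _ _ hrange).trans (AlgEquiv.ofInjective φ₂ (hinj φ₂ hφ₂)).symm)
  have hσ : ∀ x, φ₂ (σ x) = φ₁ x := by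
    intro x
    have := congrArg Subtype.val ((AlgEquiv.ofInjective φ₂ (hinj φ₂ hφ₂)).apply_symm_apply
      (Subalgebra.equivOfEq _ _ hrange (AlgEquiv.ofInjective φ₁ (hinj φ₁ hφ₁) x)))
    exact this
  refine ⟨σ, fun x ↦ hinj φ₂ hφ₂ ?_, fun h ↦ hdnil ?_⟩
  · rw [hσ, ← hφ₂, hσ, hφ₁]
  · have h1 := congrArg φ₂ h
    rw [map_mul, map_mul, hσ, hσ] at h1
    have h2 : π d = φ₁ b * φ₂ c - φ₁ c * φ₂ b := by
      rw [hd, map_sub, map_mul, map_mul]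
      rfl
    rw [h2, h1, sub_self]
    exact IsNilpotent.zero

/-- For a Picard–Vessiot ring `R` over a differential field `k` of characteristic zero
with algebraically closed constants, every element of the fraction field `K = Frac(R)`
not lying in `k` is moved by some differential `k`-automorphism of `K` (where the
derivation of `K` is the unique extension of that of `R`). -/
theorem exists_differential_automorphism_moving
    {k : Type*} [Field k] [CharZero k] (dk : k → k)
    (hdk_add : ∀ a b : k, dk (a + b) = dk a + dk b)
    (hdk_mul : ∀ a b : k, dk (a * b) = a * dk b + dk a * b)
    (hC_algClosed : ∀ p : Polynomial k, (∀ i, dk (p.coeff i) = 0) → 0 < p.degree →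
      ∃ c : k, dk c = 0 ∧ p.IsRoot c)
    {n : Type*} [Fintype n] [DecidableEq n] (A : Matrix n n k)
    {R : Type*} [CommRing R] [Algebra k R] (dR : R → R)
    (hPV : IsPicardVessiotRing dk A R dR)
    (dK : FractionRing R → FractionRing R)
    (hdK_add : ∀ x y : FractionRing R, dK (x + y) = dK x + dK y)
    (hdK_mul : ∀ x y : FractionRing R, dK (x * y) = x * dK y + dK x * y)
    (hdK_ext : ∀ a : R,
      dK (algebraMap R (FractionRing R) a) = algebraMap R (FractionRing R) (dR a))
    (a : FractionRing R)
    (ha : ¬ ∃ c : k, a = algebraMap R (FractionRing R) (algebraMap k R c)) :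
    ∃ σ : FractionRing R ≃+* FractionRing R,
      (∀ c : k, σ (algebraMap R (FractionRing R) (algebraMap k R c)) =
          algebraMap R (FractionRing R) (algebraMap k R c)) ∧
      (∀ x : FractionRing R, σ (dK x) = dK (σ x)) ∧
      σ a ≠ a := by
  obtain ⟨hadd, hmul, hcomm, hne, hsimple, Z, w, hw, hZ, hgen⟩ := hPV
  let δ : Derivation ℤ k k := Derivation.mk' (AddMonoidHom.mk' dk hdk_add).toIntLinearMap
    fun x y ↦ (hdk_mul x y).trans (by rw [mul_comm (dk x)]; rfl)
  let D : Derivation ℤ R R := Derivation.mk' (AddMonoidHom.mk' dR hadd).toIntLinearMap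
    fun x y ↦ (hmul x y).trans (by rw [mul_comm (dR x)]; rfl)
  have : Nontrivial R := by
    by_contra h
    rw [not_nontrivial_iff_subsingleton] at h
    exact hne (Subsingleton.elim _ _)
  have : IsDomain R := D.isDomain_of_forall_pow_mem k (d := 1) not_isNilpotent_one (fun I hI hI0 ↦
    ⟨0, by rw [(hsimple I hI).resolve_left hI0]; trivial⟩)
  obtain ⟨b, c, hc, rfl⟩ := IsFractionRing.div_surjective (A := R) a
  have hc0 : algebraMap R (FractionRing R) c ≠ 0 :=
    IsFractionRing.to_map_ne_zero_of_mem_nonZeroDivisors hc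
  have hbc := Algebra.TensorProduct.not_isNilpotent_tmul_sub_tmul_of_mul_eq (k := k)
    (IsScalarTower.toAlgHom k R (FractionRing R))
    (a := algebraMap R (FractionRing R) b / algebraMap R (FractionRing R) c)
    (by
      rintro ⟨r, hr⟩
      exact ha ⟨r, by rw [← hr, IsScalarTower.algebraMap_apply k R (FractionRing R)]⟩)
    (b := b) (c := c) hc0 (div_mul_cancel₀ _ hc0)
  have : Algebra.FiniteType k R := ⟨Subalgebra.fg_def.2
    ⟨_, (Set.finite_range _).union (Set.finite_singleton _), hgen⟩⟩
  have : Algebra.FiniteType R (R ⊗[k] R) := inferInstance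
  have : Algebra.FiniteType k (R ⊗[k] R) := .trans ‹Algebra.FiniteType k R› this
  obtain ⟨D₂, hD₂⟩ := Derivation.exists_tensorProduct dk D hcomm
  have hD1 : D 1 = 0 := D.map_one_eq_zero
  obtain ⟨σ, hσD, hσ⟩ := Derivation.exists_algEquiv_mul_ne_mul δ hC_algClosed A D hcomm hsimple
    hw hZ hgen D₂ Algebra.TensorProduct.includeLeft Algebra.TensorProduct.includeRight
    (fun x ↦ (hD₂ x 1).trans (by rw [hD1, tmul_zero, add_zero]; rfl))
    (fun x ↦ (hD₂ 1 x).trans (by rw [hD1, zero_tmul, zero_add]; rfl))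
    (b := b) (c := c) (by simpa using hbc)
  let τ : FractionRing R ≃+* FractionRing R :=
    IsFractionRing.ringEquivOfRingEquiv σ.toRingEquiv
  have hτ : ∀ x : R, τ (algebraMap R (FractionRing R) x) = algebraMap R (FractionRing R) (σ x) :=
    fun x ↦ IsFractionRing.ringEquivOfRingEquiv_algebraMap σ.toRingEquiv x
  have hinj : Function.Injective (algebraMap R (FractionRing R)) := IsFractionRing.injective _ _
  have hσ0 : ∀ q : R, algebraMap R (FractionRing R) q ≠ 0 →
      algebraMap R (FractionRing R) (σ q) ≠ 0 := by
    intro q hq h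
    rw [← hτ, map_eq_zero_iff τ τ.injective] at h
    exact hq h
  refine ⟨τ, fun r ↦ by rw [hτ, AlgEquiv.commutes], fun x ↦ ?_, fun h ↦ hσ ?_⟩
  · obtain ⟨p, q, hq, rfl⟩ := IsFractionRing.div_surjective (A := R) x
    have hq0 : algebraMap R (FractionRing R) q ≠ 0 :=
      IsFractionRing.to_map_ne_zero_of_mem_nonZeroDivisors hq
    set x := algebraMap R (FractionRing R) p / algebraMap R (FractionRing R) q with hx
    have hxq : algebraMap R (FractionRing R) q * x = algebraMap R (FractionRing R) p :=
      mul_div_cancel₀ _ hq0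
    have hσD' : ∀ y, σ (dR y) = dR (σ y) := hσD
    have h1 := congrArg τ (congrArg dK hxq)
    rw [hdK_mul, hdK_ext, hdK_ext, map_add, map_mul, map_mul, hτ, hτ, hτ, hσD', hσD'] at h1
    have h2 := congrArg dK (congrArg τ hxq)
    rw [map_mul, hτ, hτ, hdK_mul, hdK_ext, hdK_ext] at h2
    exact mul_left_cancel₀ (hσ0 q hq0) (by linear_combination h1 - h2)
  · rw [map_div₀, hτ, hτ, div_eq_div_iff (hσ0 c hc0) hc0, ← map_mul, ← map_mul] at h
    rw [hinj h, mul_comm]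
end

section
/- Let d denote the unique ℂ-linear derivation of the field ℂ(t) of rational functions in one variable with d(t) = 1 (the usual derivative). If a ∈ ℂ(t) is nonzero and d(d(a)/a) = 0, then d(a) = 0, i.e., a is a constant in ℂ. -/
open Polynomial in
theorem Polynomial.eq_C_of_dvd_derivative {K : Type*} [Field K] [CharZero K] {p : K[X]}
    (hp : p ∣ derivative p) : p = C (p.coeff 0) := by
  apply eq_C_of_derivative_eq_zero
  by_cases h0 : p = 0
  · simp [h0]
  · exact eq_zero_of_dvd_of_degree_lt hp (degree_derivative_lt h0)

open Polynomial in
theorem RatFunc.derivation_algebraMap {K : Type*} [Field K]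
    (d : RatFunc K → RatFunc K)
    (hd_add : ∀ a b : RatFunc K, d (a + b) = d a + d b)
    (hd_mul : ∀ a b : RatFunc K, d (a * b) = a * d b + d a * b)
    (hd_C : ∀ c : K, d (RatFunc.C c) = 0)
    (hd_X : d RatFunc.X = 1) (p : K[X]) :
    d (algebraMap K[X] (RatFunc K) p) = algebraMap K[X] (RatFunc K) (derivative p) := by
  induction p using Polynomial.induction_on with
  | C k => simp [hd_C]
  | add p q hp hq => simp [hd_add, hp, hq]
  | monomial n k ih =>
    rw [pow_succ, ← mul_assoc, map_mul, hd_mul, ih, derivative_mul, RatFunc.algebraMap_X, hd_X]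
    simp [add_comm]

open Polynomial in
/-- In characteristic zero, a rational function whose derivative is a constant multiple of itself
is constant. -/
theorem RatFunc.exists_eq_C_of_derivation_eq_C_mul {K : Type*} [Field K] [CharZero K]
    (d : RatFunc K → RatFunc K)
    (hd_add : ∀ a b : RatFunc K, d (a + b) = d a + d b)
    (hd_mul : ∀ a b : RatFunc K, d (a * b) = a * d b + d a * b)
    (hd_C : ∀ c : K, d (RatFunc.C c) = 0)
    (hd_X : d RatFunc.X = 1)
    (a : RatFunc K) (c : K) (h : d a = RatFunc.C c * a) :
    ∃ k : K, a = RatFunc.C k := by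
  have hd_poly := RatFunc.derivation_algebraMap d hd_add hd_mul hd_C hd_X
  have hq : algebraMap K[X] (RatFunc K) a.denom ≠ 0 :=
    RatFunc.algebraMap_ne_zero a.denom_ne_zero
  have haq : a * algebraMap K[X] (RatFunc K) a.denom = algebraMap K[X] (RatFunc K) a.num := by
    nth_rw 1 [← RatFunc.num_div_denom a]
    exact div_mul_cancel₀ _ hq
  have hpoly : a.num * derivative a.denom + Polynomial.C c * a.num * a.denom =
      derivative a.num * a.denom := by
    apply RatFunc.algebraMap_injective K
    have e := hd_mul a (algebraMap K[X] (RatFunc K) a.denom)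
    rw [haq, hd_poly, hd_poly, h] at e
    simp only [map_add, map_mul, RatFunc.algebraMap_C]
    rw [e, ← haq]
    ring
  have hcop := a.isCoprime_num_denom
  have hnum_dvd : a.num ∣ derivative a.num * a.denom :=
    Dvd.intro (derivative a.denom + Polynomial.C c * a.denom) (by rw [← hpoly]; ring)
  have hden_dvd : a.denom ∣ a.num * derivative a.denom :=
    Dvd.intro (derivative a.num - Polynomial.C c * a.num) (by linear_combination -hpoly)
  have hnum := eq_C_of_dvd_derivative (hcop.dvd_of_dvd_mul_right hnum_dvd)
  have hden := eq_C_of_dvd_derivative (hcop.symm.dvd_of_dvd_mul_left hden_dvd)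
  refine ⟨a.num.coeff 0 / a.denom.coeff 0, ?_⟩
  rw [map_div₀, ← RatFunc.algebraMap_C, ← RatFunc.algebraMap_C, ← hnum, ← hden,
    RatFunc.num_div_denom]


/-- For the usual derivation `d` on `ℂ(t)` (the unique `ℂ`-linear derivation with
`d(t) = 1`): if `a ∈ ℂ(t)` is nonzero and `d(d(a)/a) = 0`, then `d(a) = 0`, i.e. `a`
is a constant in `ℂ`. -/
theorem logarithmic_derivative_constant_in_ratFunc
    (d : RatFunc ℂ → RatFunc ℂ)
    (hd_add : ∀ a b : RatFunc ℂ, d (a + b) = d a + d b)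
    (hd_mul : ∀ a b : RatFunc ℂ, d (a * b) = a * d b + d a * b)
    (hd_C : ∀ c : ℂ, d (RatFunc.C c) = 0)
    (hd_X : d RatFunc.X = 1)
    (a : RatFunc ℂ) (ha : a ≠ 0) (h : d (d a / a) = 0) :
    d a = 0 ∧ ∃ c : ℂ, a = RatFunc.C c := by
  obtain ⟨c, hc⟩ := RatFunc.exists_eq_C_of_derivation_eq_C_mul d hd_add hd_mul hd_C hd_X
    (d a / a) 0 (by simp [h])
  obtain ⟨k, rfl⟩ := RatFunc.exists_eq_C_of_derivation_eq_C_mul d hd_add hd_mul hd_C hd_X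
    a c ((div_eq_iff ha).mp hc)
  exact ⟨hd_C k, k, rfl⟩
end

section
/- Let k₀ be an algebraically closed field of characteristic zero and let d denote the unique k₀-linear derivation of the rational function field k₀(x) with d(x) = 1. Then for every f ∈ k₀(x) there exist g ∈ k₀(x), a natural number r, pairwise distinct elements c₁, …, c_r ∈ k₀, and elements b₁, …, b_r ∈ k₀ such that f = d(g) + Σ_{i=1}^r b_i/(x − c_i). -/
/-- The rational functions that are a derivative plus a sum of simple pole terms. -/
def HasSimplePoleForm {K : Type*} [Field K] (D : Derivation K (RatFunc K) (RatFunc K))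
    (f : RatFunc K) : Prop :=
  ∃ (g : RatFunc K) (b : K →₀ K),
    f = D g + b.sum fun c a => RatFunc.C a / (RatFunc.X - RatFunc.C c)

namespace HasSimplePoleForm

variable {K : Type*} [Field K] {D : Derivation K (RatFunc K) (RatFunc K)}

theorem deriv (g : RatFunc K) : HasSimplePoleForm D (D g) :=
  ⟨g, 0, by simp⟩

theorem add {f₁ f₂ : RatFunc K} (h₁ : HasSimplePoleForm D f₁) (h₂ : HasSimplePoleForm D f₂) :
    HasSimplePoleForm D (f₁ + f₂) := by
  classical
  obtain ⟨g₁, b₁, rfl⟩ := h₁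
  obtain ⟨g₂, b₂, rfl⟩ := h₂
  refine ⟨g₁ + g₂, b₁ + b₂, ?_⟩
  rw [Finsupp.sum_add_index' (by simp) (by intros; rw [map_add, add_div]), map_add]
  ring

theorem sum {ι : Type*} (s : Finset ι) (f : ι → RatFunc K)
    (h : ∀ i ∈ s, HasSimplePoleForm D (f i)) : HasSimplePoleForm D (∑ i ∈ s, f i) :=
  Finset.sum_induction f _ (fun _ _ => add) (by simpa using deriv (D := D) 0) h

theorem algebraMap_polynomial [CharZero K] (hD : D RatFunc.X = 1) (p : Polynomial K) :
    HasSimplePoleForm D (algebraMap (Polynomial K) (RatFunc K) p) := by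
  induction p using Polynomial.induction_on' with
  | add p q hp hq => rw [map_add]; exact hp.add hq
  | monomial n a =>
    convert deriv (D := D) ((a / (n + 1 : K)) • RatFunc.X ^ (n + 1)) using 1
    have hn : (n + 1 : K) ≠ 0 := by exact_mod_cast n.succ_ne_zero
    have hc : RatFunc.C (a / (n + 1 : K)) * (n + 1 : RatFunc K) = RatFunc.C a := by
      rw [← map_natCast (RatFunc.C (K := K)) n, ← map_one (RatFunc.C (K := K)), ← map_add,
        ← map_mul, div_mul_cancel₀ _ hn]
    rw [D.map_smul, D.leibniz_pow, hD, ← Polynomial.C_mul_X_pow_eq_monomial, map_mul, map_pow,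
      RatFunc.algebraMap_C, RatFunc.algebraMap_X, RatFunc.smul_eq_C_mul, ← hc]
    simp [mul_assoc]

theorem _root_.RatFunc.X_sub_C_ne_zero (c : K) : (RatFunc.X - RatFunc.C c : RatFunc K) ≠ 0 := by
  rw [← RatFunc.algebraMap_X, ← RatFunc.algebraMap_C, ← map_sub]
  exact RatFunc.algebraMap_ne_zero (Polynomial.X_sub_C_ne_zero c)

theorem pole [CharZero K] (hD : D RatFunc.X = 1) (a c : K) (j : ℕ) :
    HasSimplePoleForm D (RatFunc.C a * (RatFunc.X - RatFunc.C c)⁻¹ ^ (j + 1)) := by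
  cases j with
  | zero => exact ⟨0, Finsupp.single c a, by simp [div_eq_mul_inv]⟩
  | succ n =>
    convert deriv (D := D)
      ((-(a / (n + 1 : K))) • (RatFunc.X - RatFunc.C c)⁻¹ ^ (n + 1)) using 1
    have hn : (n + 1 : K) ≠ 0 := by exact_mod_cast n.succ_ne_zero
    have hc : RatFunc.C (a / (n + 1 : K)) * (n + 1 : RatFunc K) = RatFunc.C a := by
      rw [← map_natCast (RatFunc.C (K := K)) n, ← map_one (RatFunc.C (K := K)), ← map_add,
        ← map_mul, div_mul_cancel₀ _ hn]
    have hDc : D (RatFunc.X - RatFunc.C c) = 1 := by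
      rw [map_sub, hD, ← RatFunc.algebraMap_eq_C, D.map_algebraMap, sub_zero]
    rw [D.map_smul, D.leibniz_pow, D.leibniz_inv, hDc, RatFunc.smul_eq_C_mul, ← hc]
    simp only [map_neg, smul_eq_mul, nsmul_eq_mul, Nat.add_sub_cancel]
    push_cast
    ring

theorem of_isAlgClosed [CharZero K] [IsAlgClosed K] (hD : D RatFunc.X = 1) (f : RatFunc K) :
    HasSimplePoleForm D f := by
  classical
  induction f using RatFunc.induction_on with
  | f p q hq =>
    obtain ⟨p', r, hr, h⟩ :=
      Polynomial.mul_prod_pow_inverse_eq_quo_add_sum_rem_mul_pow_inverse (K := RatFunc K)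
        (s := q.roots.toFinset) (Polynomial.C q.leadingCoeff⁻¹ * p)
        (g := fun c => Polynomial.X - Polynomial.C c)
        (fun c _ => Polynomial.monic_X_sub_C c)
        (fun _ _ _ _ hne => Polynomial.pairwise_coprime_X_sub_C Function.injective_id hne)
        (fun c => q.roots.count c) (gi := fun c => (RatFunc.X - RatFunc.C c)⁻¹)
        (fun c _ => by
          rw [map_sub, RatFunc.algebraMap_X, RatFunc.algebraMap_C,
            inv_mul_cancel₀ (RatFunc.X_sub_C_ne_zero c)])
    have hfac : algebraMap (Polynomial K) (RatFunc K) q = RatFunc.C q.leadingCoeff *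
        ∏ c ∈ q.roots.toFinset, (RatFunc.X - RatFunc.C c) ^ q.roots.count c := by
      conv_lhs => rw [(IsAlgClosed.splits q).eq_prod_roots, Finset.prod_multiset_map_count]
      simp [map_prod]
    have hpq : algebraMap (Polynomial K) (RatFunc K) p / algebraMap _ _ q =
        algebraMap (Polynomial K) (RatFunc K) (Polynomial.C q.leadingCoeff⁻¹ * p) *
          ∏ c ∈ q.roots.toFinset, (RatFunc.X - RatFunc.C c)⁻¹ ^ q.roots.count c := by
      rw [hfac, map_mul, RatFunc.algebraMap_C, map_inv₀, div_eq_mul_inv, mul_inv,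
        ← Finset.prod_inv_distrib]
      simp only [inv_pow]
      ring
    rw [hpq, h]
    refine (algebraMap_polynomial hD p').add (sum _ _ fun c hc => sum _ _ fun j _ => ?_)
    have hdeg := hr c hc j
    rw [Polynomial.degree_X_sub_C] at hdeg
    rw [Polynomial.eq_C_of_degree_le_zero (Order.le_of_lt_succ hdeg), RatFunc.algebraMap_C]
    exact pole hD _ c j

end HasSimplePoleForm


/-- Partial-fraction decomposition modulo derivatives: over an algebraically closed
field `k₀` of characteristic zero, every rational function `f ∈ k₀(x)` can be written
as `f = d(g) + Σᵢ bᵢ/(x − cᵢ)` with `g ∈ k₀(x)`, and pairwise distinct `cᵢ ∈ k₀` and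
`bᵢ ∈ k₀`, where `d` is the unique `k₀`-linear derivation of `k₀(x)` with `d(x) = 1`. -/
theorem ratFunc_eq_deriv_add_sum_simple_poles
    {k₀ : Type*} [Field k₀] [IsAlgClosed k₀] [CharZero k₀]
    (d : RatFunc k₀ → RatFunc k₀)
    (hd_add : ∀ a b : RatFunc k₀, d (a + b) = d a + d b)
    (hd_mul : ∀ a b : RatFunc k₀, d (a * b) = a * d b + d a * b)
    (hd_C : ∀ c : k₀, d (RatFunc.C c) = 0)
    (hd_X : d RatFunc.X = 1)
    (f : RatFunc k₀) :
    ∃ (g : RatFunc k₀) (r : ℕ) (c b : Fin r → k₀),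
      Function.Injective c ∧
      f = d g + ∑ i, RatFunc.C (b i) / (RatFunc.X - RatFunc.C (c i)) := by
  let D : Derivation k₀ (RatFunc k₀) (RatFunc k₀) :=
    Derivation.mk'
      { toFun := d
        map_add' := hd_add
        map_smul' := fun c a => by
          simp [RatFunc.smul_eq_C_mul, hd_mul, hd_C] }
      (fun a b => by
        simp only [LinearMap.coe_mk, AddHom.coe_mk, smul_eq_mul, hd_mul]
        ring)
  obtain ⟨g, b, h⟩ := HasSimplePoleForm.of_isAlgClosed (D := D) hd_X f
  let e := b.support.equivFin.symm
  refine ⟨g, b.support.card, fun i => e i, fun i => b (e i),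
    Subtype.val_injective.comp e.injective, h.trans ?_⟩
  congr 1
  rw [Finsupp.sum, ← Finset.sum_coe_sort]
  exact (e.sum_comp fun c : b.support =>
    RatFunc.C (b c) / (RatFunc.X - RatFunc.C (c : k₀))).symm
end

section
/- Let L be a field of characteristic zero equipped with pairwise commuting derivations d₀, d₁, …, d_m, and let k be a subfield of L closed under all of these derivations. Suppose there is a finite tower of subfields k = L₀ ⊆ L₁ ⊆ … ⊆ L_r = L, each closed under d₀, …, d_m, such that for each i, L_i is the smallest subfield of L closed under d₀, …, d_m containing L_{i−1} and an element t_i satisfying one of: (a) d₀(t_i) ∈ L_{i−1}; (b) t_i ≠ 0 and d₀(t_i)/t_i ∈ L_{i−1}; (c) t_i is algebraic over L_{i−1}. Then L = ⋃_{i∈ℕ} M_i for an increasing chain of subfields k = M₀ ⊆ M₁ ⊆ … of L (not required to be closed under the derivations) in which each M_{i+1} is generated as a field over M_i by a family of elements {t_{i,j}}_{j∈ℕ}, where each t_{i,j} satisfies one of: (a) d₀(t_{i,j}) ∈ M_i; (b) t_{i,j} ≠ 0 and d₀(t_{i,j})/t_{i,j} ∈ M_i; (c) t_{i,j} is algebraic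 over M_i. -/
/-- A derivation maps a field generated by a set `S` into itself as soon as it maps `S` into it. -/
theorem Derivation.mem_closure_of_forall_mem {L : Type*} [Field L] (D : Derivation ℤ L L)
    {S : Set L} (hS : ∀ s ∈ S, D s ∈ Subfield.closure S) {x : L}
    (hx : x ∈ Subfield.closure S) : D x ∈ Subfield.closure S := by
  induction hx using Subfield.closure_induction with
  | mem x hx => exact hS x hx
  | one => simp
  | add x y hx hy ihx ihy => rw [map_add]; exact add_mem ihx ihy
  | neg x hx ih => rw [map_neg]; exact neg_mem ih
  | inv x hx ih =>
    rw [Derivation.leibniz_inv, smul_eq_mul]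
    exact mul_mem (neg_mem (pow_mem (inv_mem hx) 2)) ih
  | mul x y hx hy ihx ihy =>
    rw [Derivation.leibniz, smul_eq_mul, smul_eq_mul]
    exact add_mem (mul_mem hx ihy) (mul_mem hy ihx)

/-- If `t` is separable algebraic over a subfield `K` closed under a derivation `D`, then `D t`
lies in every field containing `K` and `t`. -/
theorem Derivation.mem_of_isSeparable {L : Type*} [Field L] (D : Derivation ℤ L L)
    {K F : Subfield L} (hK : ∀ a ∈ K, D a ∈ K) (hKF : K ≤ F) {t : L} (htF : t ∈ F)
    (ht : IsSeparable K t) : D t ∈ F := by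
  have haeval (p : Polynomial K) : Polynomial.aeval t p ∈ F := by
    rw [Polynomial.aeval_eq_sum_range]
    refine sum_mem fun n _ => ?_
    rw [Subfield.smul_def]
    exact mul_mem (hKF (p.coeff n).2) (pow_mem htF n)
  have hD (p : Polynomial K) :
      D (Polynomial.aeval t p) - Polynomial.aeval t p.derivative * D t ∈ F := by
    induction p using Polynomial.induction_on' with
    | add p q hp hq =>
      convert add_mem hp hq using 1
      simp only [map_add]
      ring
    | monomial n a =>
      have : D (Polynomial.aeval t (Polynomial.monomial n a)) -
          Polynomial.aeval t (Polynomial.monomial n a).derivative * D t = t ^ n * D a := by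
        simp only [Polynomial.aeval_monomial, Polynomial.derivative_monomial, Derivation.leibniz,
          Derivation.leibniz_pow, smul_eq_mul, nsmul_eq_mul, map_mul]
        simp only [show ∀ b : K, algebraMap K L b = b from fun _ => rfl]
        push_cast
        ring
      rw [this]
      exact mul_mem (pow_mem htF n) (hKF (hK a a.2))
  have hne := Polynomial.Separable.aeval_derivative_ne_zero ht (minpoly.aeval K t)
  have hmem := hD (minpoly K t)
  rw [minpoly.aeval, map_zero, zero_sub] at hmem
  have := mul_mem (inv_mem (haeval (minpoly K t).derivative)) (neg_mem hmem)
  rwa [neg_neg, inv_mul_cancel_left₀ hne] at this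

/-- Membership in a subfield closed under a family of derivations is preserved by iterated
derivatives. -/
theorem Derivation.foldr_mem {L ι : Type*} [Field L] (D : ι → Derivation ℤ L L) {K : Subfield L}
    (hK : ∀ i, ∀ a ∈ K, D i a ∈ K) (w : List ι) {x : L} (hx : x ∈ K) :
    w.foldr (fun i => D i) x ∈ K := by
  induction w with
  | nil => exact hx
  | cons i w ih => exact hK i _ ih

/-- A derivation commuting with a family of derivations commutes with their composites. -/
theorem Derivation.apply_foldr {L ι : Type*} [Field L] (D : ι → Derivation ℤ L L)
    (hD : ∀ i j x, D i (D j x) = D j (D i x)) (i : ι) (w : List ι) (x : L) :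
    D i (w.foldr (fun i => D i) x) = w.foldr (fun i => D i) (D i x) := by
  induction w with
  | nil => rfl
  | cons j w ih => rw [List.foldr_cons, hD, ih, List.foldr_cons]

/-- Logarithmic derivatives of `t` along commuting derivations satisfy the integrability
condition. -/
theorem Derivation.apply_div_self_comm {L : Type*} [Field L] (D E : Derivation ℤ L L) {t : L}
    (h : D (E t) = E (D t)) : D (E t / t) = E (D t / t) := by
  rw [Derivation.leibniz_div, Derivation.leibniz_div, h]
  simp only [smul_eq_mul]
  ring

/-- The element `t` is an integral or an exponential of an integral with respect to `D`, or is
algebraic, over the subfield `K`. -/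
def IsLiouvillianOver {L : Type*} [Field L] (D : L → L) (K : Subfield L) (t : L) : Prop :=
  D t ∈ K ∨ (t ≠ 0 ∧ D t / t ∈ K) ∨
    ∃ p : Polynomial L, p ≠ 0 ∧ (∀ l, p.coeff l ∈ K) ∧ Polynomial.eval t p = 0

/-- An element killed by a nonzero polynomial with coefficients in `K` is algebraic over `K`. -/
theorem Subfield.isAlgebraic_of_coeff_mem {L : Type*} [Field L] {K : Subfield L} {t : L}
    {p : Polynomial L} (hp : p ≠ 0) (hcoeff : ∀ l, p.coeff l ∈ K)
    (heval : Polynomial.eval t p = 0) : IsAlgebraic K t := by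
  obtain ⟨q, rfl⟩ : ∃ q : Polynomial K, q.map (algebraMap K L) = p :=
    (Polynomial.mem_lifts p).mp <| (Polynomial.lifts_iff_coeff_lifts p).mpr fun l =>
      ⟨⟨p.coeff l, hcoeff l⟩, rfl⟩
  refine ⟨q, fun h => hp (by rw [h, Polynomial.map_zero]), ?_⟩
  rwa [Polynomial.eval_map_algebraMap] at heval

/-- If `K'` is the differential field generated over `K` by `t`, then any countable family in `K'`
of elements Liouvillian over `K` that generates `t`, and whose derivatives it also generates,
generates `K'` as a field. -/
theorem IsLiouvillianOver.exists_nat_family {L ι κ : Type*} [Field L] [Countable κ] [Nonempty κ]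
    (D : ι → Derivation ℤ L L) (i₀ : ι) {K K' : Subfield L} {t : L}
    (hK : ∀ i, ∀ a ∈ K, D i a ∈ K) (hKK' : K ≤ K')
    (hmin : ∀ F : Subfield L, (∀ i, ∀ a ∈ F, D i a ∈ F) → K ≤ F → t ∈ F → K' ≤ F)
    (f : κ → L) (hf : ∀ j, f j ∈ K')
    (ht : t ∈ Subfield.closure ((K : Set L) ∪ Set.range f))
    (hDf : ∀ i j, D i (f j) ∈ Subfield.closure ((K : Set L) ∪ Set.range f))
    (hL : ∀ j, IsLiouvillianOver (D i₀) K (f j)) :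
    ∃ g : ℕ → L, K' = Subfield.closure ((K : Set L) ∪ Set.range g) ∧
      ∀ j, IsLiouvillianOver (D i₀) K (g j) := by
  obtain ⟨e, he⟩ := exists_surjective_nat κ
  refine ⟨f ∘ e, ?_, fun j => hL (e j)⟩
  rw [he.range_comp]
  have hKc : (K : Set L) ⊆ Subfield.closure ((K : Set L) ∪ Set.range f) :=
    Set.subset_union_left.trans Subfield.subset_closure
  refine le_antisymm (hmin _ (fun i a ha => ?_) hKc ht) (Subfield.closure_le.mpr ?_)
  · refine (D i).mem_closure_of_forall_mem ?_ ha
    rintro s (hs | ⟨j, rfl⟩)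
    · exact hKc (hK i s hs)
    · exact hDf i j
  · rintro s (hs | ⟨j, rfl⟩)
    · exact hKK' hs
    · exact hf j

/-- A differential field generated over `K` by a single Liouvillian element is generated as a
field over `K` by countably many Liouvillian elements. -/
theorem IsLiouvillianOver.exists_generating_family {L ι : Type*} [Field L] [CharZero L]
    [Countable ι] (D : ι → Derivation ℤ L L) (hD : ∀ i j x, D i (D j x) = D j (D i x)) (i₀ : ι)
    {K K' : Subfield L} {t : L} (ht : IsLiouvillianOver (D i₀) K t)
    (hK : ∀ i, ∀ a ∈ K, D i a ∈ K) (hK' : ∀ i, ∀ a ∈ K', D i a ∈ K')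
    (hKK' : K ≤ K') (htK' : t ∈ K')
    (hmin : ∀ F : Subfield L, (∀ i, ∀ a ∈ F, D i a ∈ F) → K ≤ F → t ∈ F → K' ≤ F) :
    ∃ f : ℕ → L, K' = Subfield.closure ((K : Set L) ∪ Set.range f) ∧
      ∀ j, IsLiouvillianOver (D i₀) K (f j) := by
  have hgen {S : Set L} {x : L} (hx : x ∈ S) : x ∈ Subfield.closure ((K : Set L) ∪ S) :=
    Subfield.subset_closure (Or.inr hx)
  rcases ht with ht | ⟨ht0, ht⟩ | ⟨p, hp, hcoeff, heval⟩
  · refine exists_nat_family D i₀ hK hKK' hmin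
      (fun w : List ι => w.foldr (fun i => D i) t) (fun w => Derivation.foldr_mem D hK' w htK')
      (hgen ⟨[], rfl⟩) (fun i w => hgen ⟨i :: w, rfl⟩) fun w => Or.inl ?_
    rw [Derivation.apply_foldr D hD]
    exact Derivation.foldr_mem D hK w ht
  · let f : Option (ι × List ι) → L := fun o =>
      o.elim t fun q => q.2.foldr (fun i => D i) (D q.1 t / t)
    refine exists_nat_family D i₀ hK hKK' hmin f ?_ (hgen ⟨none, rfl⟩) ?_ ?_
    · rintro (_ | ⟨i, w⟩)
      · exact htK'
      · exact Derivation.foldr_mem D hK' w (div_mem (hK' i t htK') htK')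
    · rintro i (_ | ⟨j, w⟩)
      · have := mul_mem (hgen (Set.mem_range_self (f := f) (some (i, []))))
          (hgen (Set.mem_range_self (f := f) none))
        simpa [f, div_mul_cancel₀ _ ht0] using this
      · exact hgen ⟨some (j, i :: w), rfl⟩
    · rintro (_ | ⟨i, w⟩)
      · exact Or.inr (Or.inl ⟨ht0, ht⟩)
      · refine Or.inl ?_
        change D i₀ (w.foldr (fun i => D i) (D i t / t)) ∈ K
        rw [Derivation.apply_foldr D hD,
          Derivation.apply_div_self_comm (D i₀) (D i) (hD i₀ i t)]
        exact Derivation.foldr_mem D hK w (hK i _ ht)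
  · have halg := Subfield.isAlgebraic_of_coeff_mem hp hcoeff heval
    refine exists_nat_family D i₀ hK hKK' hmin (fun _ : Unit => t) (fun _ => htK')
      (hgen ⟨(), rfl⟩) (fun i _ => ?_) fun _ => Or.inr (Or.inr ⟨p, hp, hcoeff, heval⟩)
    exact (D i).mem_of_isSeparable (hK i)
      (Set.subset_union_left.trans Subfield.subset_closure) (hgen ⟨(), rfl⟩)
      (minpoly.irreducible halg.isIntegral).separable


/-- If `L` is a parameterized liouvillian extension of `k` (a finite tower of
differential subfields, each differentially generated over the previous one by a
parameterized integral, a parameterized exponential of an integral, or an algebraic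
element), then `L` is the union of an increasing chain of subfields `k = M₀ ⊆ M₁ ⊆ …`
where each `M_{i+1}` is generated as a field over `M_i` by a countable family of
elements each of which is a `d₀`-integral, a `d₀`-exponential of an integral, or
algebraic over `M_i`. -/
theorem liouvillian_tower_refinement
    {L : Type*} [Field L] [CharZero L] {m : ℕ}
    (d : Fin (m + 1) → L → L)
    (hd_add : ∀ i, ∀ a b : L, d i (a + b) = d i a + d i b)
    (hd_mul : ∀ i, ∀ a b : L, d i (a * b) = a * d i b + d i a * b)
    (hd_comm : ∀ i j, ∀ x : L, d i (d j x) = d j (d i x))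
    (k : Subfield L) (hk : ∀ i, ∀ a ∈ k, d i a ∈ k)
    (r : ℕ) (Lt : Fin (r + 1) → Subfield L)
    (hfirst : Lt 0 = k) (hlast : Lt (Fin.last r) = ⊤)
    (hclosed : ∀ s i, ∀ a ∈ Lt s, d i a ∈ Lt s)
    (hstep : ∀ s : Fin r, ∃ t : L,
      ((d 0 t ∈ Lt s.castSucc) ∨
        (t ≠ 0 ∧ d 0 t / t ∈ Lt s.castSucc) ∨
        (∃ p : Polynomial L, p ≠ 0 ∧ (∀ j, p.coeff j ∈ Lt s.castSucc) ∧
          Polynomial.eval t p = 0)) ∧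
      Lt s.castSucc ≤ Lt s.succ ∧ t ∈ Lt s.succ ∧
      (∀ F : Subfield L, (∀ i, ∀ a ∈ F, d i a ∈ F) →
        Lt s.castSucc ≤ F → t ∈ F → Lt s.succ ≤ F)) :
    ∃ M : ℕ → Subfield L,
      M 0 = k ∧
      (∀ i, M i ≤ M (i + 1)) ∧
      (∀ x : L, ∃ i, x ∈ M i) ∧
      (∀ i : ℕ, ∃ t : ℕ → L,
        M (i + 1) = Subfield.closure ((M i : Set L) ∪ Set.range t) ∧
        ∀ j : ℕ,
          (d 0 (t j) ∈ M i) ∨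
          (t j ≠ 0 ∧ d 0 (t j) / t j ∈ M i) ∨
          (∃ p : Polynomial L, p ≠ 0 ∧ (∀ l, p.coeff l ∈ M i) ∧
            Polynomial.eval (t j) p = 0)) := by
  let D (i : Fin (m + 1)) : Derivation ℤ L L :=
    Derivation.mk' (AddMonoidHom.mk' (d i) (hd_add i)).toIntLinearMap fun a b =>
      (hd_mul i a b).trans (by simp [mul_comm])
  let M (n : ℕ) : Subfield L := Lt (Fin.ofNat (r + 1) (min n r))
  have hM (n : ℕ) (hn : n < r) :
      M n = Lt (Fin.castSucc ⟨n, hn⟩) ∧ M (n + 1) = Lt (Fin.succ ⟨n, hn⟩) := by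
    constructor <;> refine congrArg Lt (Fin.ext ?_) <;> simp [Fin.ofNat] <;>
      first | omega | (rw [Nat.mod_eq_of_lt] <;> omega)
  have hMtop (n : ℕ) (hn : r ≤ n) : M n = ⊤ := by
    rw [← hlast]
    refine congrArg Lt (Fin.ext ?_)
    simp [hn]
  have hstable (n : ℕ) : ∃ t : ℕ → L,
      M (n + 1) = Subfield.closure ((M n : Set L) ∪ Set.range t) ∧
        ∀ j, IsLiouvillianOver (d 0) (M n) (t j) := by
    by_cases hn : n < r
    · obtain ⟨t, ht, hle, hmem, hmin⟩ := hstep ⟨n, hn⟩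
      rw [(hM n hn).1, (hM n hn).2]
      exact IsLiouvillianOver.exists_generating_family D hd_comm 0 ht
        (hclosed _) (hclosed _) hle hmem hmin
    · refine ⟨fun _ => 0, ?_, fun j => Or.inl ?_⟩
      · rw [hMtop n (by omega), hMtop (n + 1) (by omega)]
        simp
      · rw [hMtop n (by omega)]
        exact Subfield.mem_top _
  refine ⟨M, ?_, fun n => ?_, fun x => ⟨r, ?_⟩, hstable⟩
  · rw [← hfirst]
    exact congrArg Lt (Fin.ext (by simp))
  · obtain ⟨t, ht, -⟩ := hstable n
    rw [ht]
    exact Set.subset_union_left.trans Subfield.subset_closure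
  · rw [hMtop r le_rfl]
    exact Subfield.mem_top x
end

section
/- Let k ⊆ K be differential fields of characteristic zero with derivation d (the derivation of K restricting to that of k), and assume that the field of constants of K equals the field of constants C of k. Let A be an n×n matrix over k with trace(A) = 0, and let Z be an invertible n×n matrix over K with d(Z) = A·Z (d applied entrywise). Then det(Z) lies in C (in particular in k), and for every k-algebra automorphism σ of K commuting with d, the matrix M = Z⁻¹·σ(Z) has all its entries in C and satisfies det(M) = 1. -/
/-- A derivation applied entrywise satisfies the Leibniz rule for matrix products. -/
theorem Derivation.map_matrix_mul {R A : Type*} [CommSemiring R] [CommSemiring A] [Algebra R A]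
    (D : Derivation R A A) {l m n : Type*} [Fintype m]
    (X : Matrix l m A) (Y : Matrix m n A) :
    (X * Y).map D = X * Y.map D + X.map D * Y := by
  ext i j
  simp [Matrix.mul_apply, Finset.sum_add_distrib, mul_comm]

/-- The Leibniz rule for a finite product. -/
theorem Derivation.leibniz_finset_prod {R A : Type*} [CommSemiring R] [CommSemiring A]
    [Algebra R A] (D : Derivation R A A) {ι : Type*} [DecidableEq ι] (s : Finset ι) (f : ι → A) :
    D (∏ i ∈ s, f i) = ∑ i ∈ s, D (f i) * ∏ j ∈ s.erase i, f j := by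
  induction s using Finset.induction_on with
  | empty => simp
  | insert a s ha ih =>
    rw [Finset.prod_insert ha, D.leibniz, ih, Finset.sum_insert ha, Finset.erase_insert ha,
      smul_eq_mul, smul_eq_mul, add_comm, mul_comm, Finset.mul_sum]
    congr 1
    refine Finset.sum_congr rfl fun i hi => ?_
    have hai : a ≠ i := fun h => ha (h ▸ hi)
    rw [Finset.erase_insert_of_ne hai, Finset.prod_insert (by simp [ha])]
    ring

/-- The derivative of a determinant is obtained by differentiating one row at a time. -/
theorem Derivation.map_det {R A : Type*} [CommSemiring R] [CommRing A] [Algebra R A]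
    (D : Derivation R A A) {n : Type*} [Fintype n] [DecidableEq n] (Z : Matrix n n A) :
    D Z.det = ∑ i, (Z.updateRow i (Z.map D i)).det := by
  have det_eq (M : Matrix n n A) :
      M.det = ∑ τ : Equiv.Perm n, Equiv.Perm.sign τ • ∏ i, M i (τ i) := by
    rw [← Matrix.det_transpose, Matrix.det_apply]
    rfl
  simp only [det_eq]
  rw [map_sum, Finset.sum_comm]
  refine Finset.sum_congr rfl fun τ _ => ?_
  rw [Units.smul_def, map_zsmul, D.leibniz_finset_prod, Finset.smul_sum]
  refine Finset.sum_congr rfl fun i _ => ?_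
  rw [← Finset.mul_prod_erase Finset.univ _ (Finset.mem_univ i), Units.smul_def,
    Matrix.updateRow_self, Matrix.map_apply]
  congr 2
  refine Finset.prod_congr rfl fun j hj => ?_
  rw [Matrix.updateRow_ne (Finset.ne_of_mem_erase hj)]

/-- Liouville's formula for a solution of a linear differential system. -/
theorem Derivation.map_det_of_map_eq_mul {R A : Type*} [CommSemiring R] [CommRing A] [Algebra R A]
    (D : Derivation R A A) {n : Type*} [Fintype n] [DecidableEq n] {B Z : Matrix n n A}
    (hZ : Z.map D = B * Z) : D Z.det = B.trace * Z.det := by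
  rw [D.map_det, Matrix.trace, Finset.sum_mul]
  refine Finset.sum_congr rfl fun i _ => ?_
  have hrow : Z.map D i = ∑ j, B i j • Z j := by
    ext l
    rw [hZ]
    simp [Matrix.mul_apply]
  rw [hrow, Matrix.det_updateRow_sum, smul_eq_mul, Matrix.diag_apply]


/-- Let `k ⊆ K` be differential fields of characteristic zero with the same constants
`C`, let `A` be a trace-zero matrix over `k`, and let `Z` be an invertible matrix over
`K` with `d(Z) = A·Z`.  Then `det Z` is a constant (in particular lies in `k`), and
for every differential `k`-automorphism `σ` of `K`, the matrix `M = Z⁻¹·σ(Z)` has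
constant entries and determinant `1`. -/
theorem galois_action_on_fundamental_matrix_sl
    {K : Type*} [Field K] [CharZero K] (d : K → K)
    (hd_add : ∀ a b : K, d (a + b) = d a + d b)
    (hd_mul : ∀ a b : K, d (a * b) = a * d b + d a * b)
    (k : Subfield K) (hk : ∀ a ∈ k, d a ∈ k)
    (hconst : ∀ a : K, d a = 0 → a ∈ k)
    {n : Type*} [Fintype n] [DecidableEq n]
    (A : Matrix n n K) (hA : ∀ i j, A i j ∈ k) (htrace : A.trace = 0)
    (Z : Matrix n n K) (hZunit : IsUnit Z.det)
    (hZ : Z.map d = A * Z) :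
    d Z.det = 0 ∧ Z.det ∈ k ∧
    ∀ σ : K ≃+* K, (∀ c ∈ k, σ c = c) → (∀ x : K, σ (d x) = d (σ x)) →
      (∀ i j, d ((Z⁻¹ * Z.map (fun x => σ x)) i j) = 0) ∧
      (Z⁻¹ * Z.map (fun x => σ x)).det = 1 := by
  let D : Derivation ℤ K K :=
    Derivation.mk' (AddMonoidHom.mk' d hd_add).toIntLinearMap fun a b => by
      simp [hd_mul, mul_comm]
  have hD : Z.map D = A * Z := hZ
  have hdet : d Z.det = 0 := by
    have h := D.map_det_of_map_eq_mul hD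
    rwa [htrace, zero_mul] at h
  refine ⟨hdet, hconst _ hdet, fun σ hσ hσd => ?_⟩
  set W := Z.map (fun x => σ x) with hW
  have hWdet : W.det = Z.det := by
    have h : σ Z.det = W.det := RingHom.map_det (σ : K →+* K) Z
    rw [← h, hσ _ (hconst _ hdet)]
  have hWD : W.map D = A * W := by
    ext i j
    have h : d (Z i j) = (A * Z) i j := congr_fun (congr_fun hZ i) j
    change d (σ (Z i j)) = _
    rw [← hσd, h]
    simp [hW, Matrix.mul_apply, hσ _ (hA _ _)]
  constructor
  · have h := D.map_matrix_mul Z (Z⁻¹ * W)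
    rw [Matrix.mul_nonsing_inv_cancel_left _ _ hZunit, hWD, hD, Matrix.mul_assoc,
      Matrix.mul_nonsing_inv_cancel_left _ _ hZunit, right_eq_add] at h
    have h0 : (Z⁻¹ * W).map D = 0 := by
      rw [← Matrix.nonsing_inv_mul_cancel_left Z ((Z⁻¹ * W).map D) hZunit, h, Matrix.mul_zero]
    exact fun i j => congr_fun (congr_fun h0 i) j
  · rw [Matrix.det_mul, hWdet, ← Matrix.det_mul, Matrix.nonsing_inv_mul _ hZunit, Matrix.det_one]
end
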